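/- arXiv:1311.4146 — 4 statements merged into one kernel-verified Lean document; each statement's English description precedes it below -/
import Mathlib

section
/- Let N ≥ 2, r > 0, δ ∈ πrℤ, 0 < t* < ∞. Then the function u(t, x) := h_N^A(t* − t, x), defined for (t, x) ∈ [0, t*) × ℝ^N, satisfies the backward heat equation ∂u/∂t(t,x) + (1/2)·Σ_{j=1}^N ∂²u/∂x_j²(t,x) = 0 for all (t, x) ∈ [0, t*) × ℝ^N. -/
/-- The Jacobi theta function
`ϑ1(v;τ) = i ∑_{n ∈ ℤ} (-1)^n e^{iπτ(n-1/2)^2} e^{iπ(2n-1)v}`. -/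
noncomputable def theta1 (v τ : ℂ) : ℂ :=
  Complex.I * ∑' n : ℤ, (-1 : ℂ) ^ n *
    Complex.exp (Real.pi * Complex.I * τ * ((n : ℂ) - 1 / 2) ^ 2) *
    Complex.exp (Real.pi * Complex.I * (2 * (n : ℂ) - 1) * v)

/-- The function `h_N^A(s, x)` of the paper. -/
noncomputable def hA (N : ℕ) (r tstar δ : ℝ) (s : ℝ) (x : Fin N → ℝ) : ℂ :=
  ((Real.exp (-((N : ℝ) * ((N : ℝ) - 1) * ((N : ℝ) - 2) * tstar) / (48 * r ^ 2)) : ℝ) : ℂ) *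
    ((Real.exp (-((N : ℝ) * s) / (24 * r ^ 2)) *
        ∏' n : ℕ, (1 - Real.exp (-(((n : ℝ) + 1) * N * s) / r ^ 2)) : ℝ) : ℂ) ^
      (-((((N - 1) * (N - 2) / 2 : ℕ)) : ℤ)) *
    theta1 ((((δ + ∑ j, x j) / (2 * Real.pi * r) : ℝ)) : ℂ)
      (Complex.I * N * s / (2 * Real.pi * r ^ 2)) *
    ∏ j : Fin N, ∏ k : Fin N, if j < k then
      theta1 ((((x k - x j) / (2 * Real.pi * r) : ℝ)) : ℂ)
        (Complex.I * N * s / (2 * Real.pi * r ^ 2)) else 1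


noncomputable def wt (c : ℝ) (j : ℕ) (s y : ℝ) (n : ℤ) : ℂ :=
  (-1 : ℂ) ^ n * (((n : ℝ) - c : ℝ) : ℂ) ^ j *
    Complex.exp ((-(s * ((n : ℝ) - c) ^ 2) : ℝ) : ℂ) *
    Complex.exp (Complex.I * ((((n : ℝ) - c) * y : ℝ) : ℂ))

noncomputable def W (c : ℝ) (j : ℕ) (s y : ℝ) : ℂ := ∑' n : ℤ, wt c j s y n

lemma norm_wt (c : ℝ) (j : ℕ) (s y : ℝ) (n : ℤ) :
    ‖wt c j s y n‖ = |(n : ℝ) - c| ^ j * Real.exp (-(s * ((n : ℝ) - c) ^ 2)) := by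
  unfold wt
  rw [norm_mul, norm_mul, norm_mul, mul_comm Complex.I, Complex.norm_exp_ofReal_mul_I,
    norm_zpow, norm_neg, norm_one, one_zpow, norm_pow, Complex.norm_real, Complex.norm_exp,
    Complex.ofReal_re, Real.norm_eq_abs]
  ring

lemma summable_bd (c : ℝ) (j : ℕ) {s : ℝ} (hs : 0 < s) :
    Summable (fun n : ℤ => |(n : ℝ) - c| ^ j * Real.exp (-(s * ((n : ℝ) - c) ^ 2))) := by
  have hT : 0 < s / Real.pi := div_pos hs Real.pi_pos
  have h := (summable_pow_mul_jacobiTheta₂_term_bound ((2 * s * |c| + 1) / (2 * Real.pi)) hT 0).mul_left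
    ((j.factorial : ℝ) * Real.exp |c|)
  refine Summable.of_nonneg_of_le (fun n => by positivity) (fun n => ?_) h
  have hpi := Real.pi_pos
  have h1 : |(n : ℝ) - c| ^ j ≤ j.factorial * Real.exp |(n : ℝ) - c| := by
    have := Real.pow_div_factorial_le_exp |(n : ℝ) - c| (abs_nonneg ((n : ℝ) - c)) j
    rw [div_le_iff₀ (by positivity)] at this
    linarith
  have h2 : |(n : ℝ) - c| ≤ |(n : ℝ)| + |c| := abs_sub _ _
  have h3 : (n : ℝ) * c ≤ |(n : ℝ)| * |c| := by rw [← abs_mul]; exact le_abs_self _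
  calc |(n : ℝ) - c| ^ j * Real.exp (-(s * ((n : ℝ) - c) ^ 2))
      ≤ (j.factorial * Real.exp |(n : ℝ) - c|) * Real.exp (-(s * ((n : ℝ) - c) ^ 2)) := by gcongr
    _ = j.factorial * Real.exp (|(n : ℝ) - c| + -(s * ((n : ℝ) - c) ^ 2)) := by
        rw [Real.exp_add]; ring
    _ ≤ j.factorial * Real.exp (|c| + -Real.pi * (s / Real.pi * n ^ 2 -
          2 * ((2 * s * |c| + 1) / (2 * Real.pi)) * |(n:ℝ)|)) := by
        have e : -Real.pi * (s / Real.pi * n ^ 2 -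
          2 * ((2 * s * |c| + 1) / (2 * Real.pi)) * |(n:ℝ)|) = -(s * n^2) + (2 * s * |c| + 1) * |(n:ℝ)| := by
          field_simp; ring
        rw [e]
        refine mul_le_mul_of_nonneg_left (Real.exp_le_exp.mpr ?_) (by positivity)
        nlinarith [mul_le_mul_of_nonneg_left h3 hs.le, mul_nonneg hs.le (sq_nonneg c)]
    _ = _ := by rw [Real.exp_add]; push_cast; ring

lemma summable_norm_wt (c : ℝ) (j : ℕ) {s : ℝ} (hs : 0 < s) (y : ℝ) :
    Summable (fun n => ‖wt c j s y n‖) := by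
  simp_rw [norm_wt]; exact summable_bd c j hs

lemma summable_wt (c : ℝ) (j : ℕ) {s : ℝ} (hs : 0 < s) (y : ℝ) :
    Summable (wt c j s y) := (summable_norm_wt c j hs y).of_norm

lemma wt_deriv_y (c : ℝ) (j : ℕ) (s y : ℝ) (n : ℤ) :
    HasDerivAt (fun y => wt c j s y n) (Complex.I * wt c (j + 1) s y n) y := by
  unfold wt
  have h : HasDerivAt (fun y : ℝ => Complex.I * ((((n : ℝ) - c) * y : ℝ) : ℂ))
      (Complex.I * (((n : ℝ) - c : ℝ) : ℂ)) y := by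
    have := ((hasDerivAt_id y).const_mul ((n : ℝ) - c)).ofReal_comp.const_mul Complex.I
    simpa using this
  refine (h.cexp.const_mul _).congr_deriv ?_
  rw [pow_succ]; ring

lemma wt_deriv_s (c : ℝ) (j : ℕ) (s y : ℝ) (n : ℤ) :
    HasDerivAt (fun s => wt c j s y n) (-wt c (j + 2) s y n) s := by
  unfold wt
  have h : HasDerivAt (fun s : ℝ => ((-(s * ((n : ℝ) - c) ^ 2) : ℝ) : ℂ))
      (-(((n : ℝ) - c : ℝ) : ℂ) ^ 2) s := by
    have := ((hasDerivAt_id s).mul_const (((n : ℝ) - c) ^ 2)).neg.ofReal_comp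
    simpa using this
  refine ((h.cexp.const_mul _).mul_const _).congr_deriv ?_
  ring

lemma W_deriv_y (c : ℝ) (j : ℕ) {s : ℝ} (hs : 0 < s) (y : ℝ) :
    HasDerivAt (fun y => W c j s y) (Complex.I * W c (j + 1) s y) y := by
  unfold W
  rw [← tsum_mul_left]
  refine hasDerivAt_tsum (summable_bd c (j + 1) hs) (fun n y => wt_deriv_y c j s y n)
    (fun n y => ?_) (summable_wt c j hs y) y
  rw [norm_mul, Complex.norm_I, one_mul, norm_wt]

lemma W_deriv_s (c : ℝ) (j : ℕ) {s : ℝ} (hs : 0 < s) (y : ℝ) :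
    HasDerivAt (fun s => W c j s y) (-W c (j + 2) s y) s := by
  unfold W
  rw [← tsum_neg]
  refine hasDerivAt_tsum_of_isPreconnected (t := Set.Ioi (s / 2)) (summable_bd c (j + 2) (half_pos hs)) isOpen_Ioi
    isPreconnected_Ioi (fun n s _ => wt_deriv_s c j s y n)
    (fun n s' h => ?_) (y₀ := s) (by simp [hs]) (summable_wt c j hs y) (by simp [hs])
  rw [norm_neg, norm_wt]
  have : s / 2 ≤ s' := le_of_lt h
  gcongr

lemma wt_refl (j : ℕ) (s y : ℝ) (n : ℤ) :
    wt (1/2) j s (-y) (1 - n) = (-1) ^ (j + 1) * wt (1/2) j s y n := by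
  unfold wt
  have h1 : (((1 - n : ℤ) : ℝ) - 1/2) = -((n : ℝ) - 1/2) := by push_cast; ring
  rw [h1, zpow_sub₀ (by norm_num)]
  have h2 : ((-1 : ℂ) ^ n)⁻¹ = (-1) ^ n := by
    rw [← inv_zpow]; norm_num
  rw [zpow_one, div_eq_mul_inv, h2, neg_sq, neg_mul_neg, Complex.ofReal_neg, neg_pow]
  ring

lemma W_refl (j : ℕ) (s y : ℝ) :
    W (1/2) j s (-y) = (-1) ^ (j + 1) * W (1/2) j s y := by
  unfold W
  rw [← tsum_mul_left, ← (Equiv.subLeft (1 : ℤ)).tsum_eq]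
  exact tsum_congr fun n => wt_refl j s y n

lemma W_shift (c : ℝ) (m : ℤ) (j : ℕ) (s : ℝ) :
    W (c - m) j s 0 = (-1) ^ m * W c j s 0 := by
  unfold W
  rw [← tsum_mul_left, ← (Equiv.addRight m).tsum_eq (fun n => (-1 : ℂ) ^ m * wt c j s 0 n)]
  refine tsum_congr fun n => ?_
  simp only [Equiv.coe_addRight]
  unfold wt
  have h1 : ((n : ℝ) - (c - m)) = (((n + m : ℤ) : ℝ) - c) := by push_cast; ring
  have h2 : (-1 : ℂ) ^ n = (-1) ^ m * (-1) ^ (n + m) := by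
    rw [← zpow_add₀ (by norm_num), show m + (n + m) = n + (m + m) by ring,
      zpow_add₀ (by norm_num), Even.neg_one_zpow (Even.add_self m), mul_one]
  rw [h1, h2]; ring

lemma W_neg_even (c : ℝ) (j : ℕ) (hj : Even j) (s : ℝ) :
    W (-c) j s 0 = W c j s 0 := by
  unfold W
  rw [← (Equiv.neg ℤ).tsum_eq]
  refine tsum_congr fun n => ?_
  simp only [Equiv.neg_apply]
  unfold wt
  have h1 : (((-n : ℤ) : ℝ) - -c) = -((n : ℝ) - c) := by push_cast; ring
  have h2 : ((-1 : ℂ) ^ (-n)) = (-1) ^ n := by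
    rw [← inv_zpow']; norm_num
  rw [h1, h2, neg_sq, Complex.ofReal_neg, hj.neg_pow]
  simp

lemma W_half_zero (j : ℕ) (hj : Even j) (s : ℝ) : W (1/2) j s 0 = 0 := by
  have := W_refl j s 0
  rw [neg_zero, pow_succ, hj.neg_one_pow] at this
  linear_combination this / 2

lemma W_ratio (D : ℤ) (s : ℝ) :
    W (1/6) 0 s 0 * W (1/2 - D / 3) 2 s 0 = W (1/6) 2 s 0 * W (1/2 - D / 3) 0 s 0 := by
  have h0 : Even 0 := ⟨0, rfl⟩
  have h2 : Even 2 := ⟨1, rfl⟩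
  obtain ⟨m, h | h | h⟩ : ∃ m : ℤ, D = 3 * m ∨ D = 3 * m + 1 ∨ D = 3 * m + 2 :=
    ⟨D / 3, by omega⟩
  · have e : (1/2 - (D : ℝ) / 3) = 1/2 - m := by rw [h]; push_cast; ring
    rw [e, W_shift, W_shift, W_half_zero _ h0, W_half_zero _ h2]; ring
  · have e : (1/2 - (D : ℝ) / 3) = 1/6 - m := by rw [h]; push_cast; ring
    rw [e, W_shift, W_shift]; ring
  · have e : (1/2 - (D : ℝ) / 3) = -(1/6) - m := by rw [h]; push_cast; ring
    rw [e, W_shift, W_shift, W_neg_even _ _ h0, W_neg_even _ _ h2]; ring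

lemma wt_pow (c : ℝ) (j : ℕ) (s y : ℝ) (n : ℤ) :
    wt c j s y n = (((n : ℝ) - c : ℝ) : ℂ) ^ j * wt c 0 s y n := by
  unfold wt; ring

noncomputable def base (s a b c : ℝ) (p : ℤ × ℤ × ℤ) : ℂ :=
  wt (1/2) 0 s a p.1 * (wt (1/2) 0 s b p.2.1 * wt (1/2) 0 s c p.2.2)

noncomputable def hf (n : ℤ) : ℂ := (((n : ℝ) - 1/2 : ℝ) : ℂ)

lemma triple_hasSum {s : ℝ} (hs : 0 < s) (a b c : ℝ) (i j k : ℕ) :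
    HasSum (fun p : ℤ × ℤ × ℤ => hf p.1 ^ i * hf p.2.1 ^ j * hf p.2.2 ^ k * base s a b c p)
      (W (1/2) i s a * W (1/2) j s b * W (1/2) k s c) := by
  have h1 := summable_norm_wt (1/2) i hs a
  have h2 := summable_norm_wt (1/2) j hs b
  have h3 := summable_norm_wt (1/2) k hs c
  have h23 := h2.mul_norm h3
  have e : (fun p : ℤ × ℤ × ℤ => hf p.1 ^ i * hf p.2.1 ^ j * hf p.2.2 ^ k * base s a b c p)
     = fun p : ℤ × ℤ × ℤ => wt (1/2) i s a p.1 * (wt (1/2) j s b p.2.1 * wt (1/2) k s c p.2.2) := by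
    funext p
    rw [wt_pow _ i, wt_pow _ j, wt_pow _ k]
    unfold base hf
    ring
  rw [e]
  have hsum := summable_mul_of_summable_norm h1 h23
  rw [hsum.hasSum_iff]
  unfold W
  rw [mul_assoc, tsum_mul_tsum_of_summable_norm h2 h3, tsum_mul_tsum_of_summable_norm h1 h23]

def shearEquiv : (ℤ × ℤ) × ℤ ≃ ℤ × ℤ × ℤ where
  toFun q := (q.1.1 + q.2, q.1.2 + q.2, q.2)
  invFun p := ((p.1 - p.2.2, p.2.1 - p.2.2), p.2.2)
  left_inv q := by ext <;> simp
  right_inv p := by ext <;> simp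

noncomputable def shC (s a b : ℝ) (d : ℤ × ℤ) : ℂ :=
  (-1 : ℂ) ^ (d.1 + d.2) *
   Complex.exp ((-(s * ((d.1 : ℝ) ^ 2 + (d.2 : ℝ) ^ 2 - ((d.1 : ℝ) + d.2) ^ 2 / 3)) : ℝ) : ℂ) *
   Complex.exp (Complex.I * ((d.1 * a + d.2 * b : ℝ) : ℂ))

lemma base_shear (s a b : ℝ) (j : ℕ) (d : ℤ × ℤ) (k : ℤ) :
    (hf (d.1 + k) + hf (d.2 + k) + hf k) ^ j * base s a b (-a - b) (shearEquiv (d, k)) =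
    shC s a b d * 3 ^ j * wt (1/2 - ((d.1 + d.2 : ℤ) : ℝ) / 3) j (3 * s) 0 k := by
  obtain ⟨d, e⟩ := d
  have hu : (hf (d + k) + hf (e + k) + hf k) =
      3 * (((k : ℝ) - (1/2 - ((d + e : ℤ) : ℝ) / 3) : ℝ) : ℂ) := by
    unfold hf; push_cast; ring
  simp only [shearEquiv, base, shC, wt, Equiv.coe_fn_mk, pow_zero, mul_one, hu]
  have hz : (-1 : ℂ) ^ (d + k) * ((-1) ^ (e + k) * (-1) ^ k) = (-1) ^ (d + e) * (-1) ^ k := by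
    rw [← zpow_add₀ (by norm_num), ← zpow_add₀ (by norm_num), ← zpow_add₀ (by norm_num),
      show d + k + (e + k + k) = d + e + k + (k + k) by ring,
      zpow_add₀ (by norm_num) (d + e + k), Even.neg_one_zpow (Even.add_self k), mul_one]
  rw [mul_pow]
  have hexp : ∀ X Y Z X' Y' Z' A A' B B' : ℂ, X + Y + Z + X' + Y' + Z' = A + A' + B + B' →
      Complex.exp X * Complex.exp X' * (Complex.exp Y * Complex.exp Y' * (Complex.exp Z * Complex.exp Z'))
       = Complex.exp A * Complex.exp A' * (Complex.exp B * Complex.exp B') := by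
    intro X Y Z X' Y' Z' A A' B B' h
    simp only [← Complex.exp_add]
    congr 1
    linear_combination h
  have := hexp (-(s * (((d + k : ℤ) : ℝ) - 1/2) ^ 2) : ℝ) (-(s * (((e + k : ℤ) : ℝ) - 1/2) ^ 2) : ℝ)
    (-(s * ((k : ℝ) - 1/2) ^ 2) : ℝ)
    (Complex.I * (((((d + k : ℤ) : ℝ) - 1/2) * a : ℝ) : ℂ))
    (Complex.I * (((((e + k : ℤ) : ℝ) - 1/2) * b : ℝ) : ℂ))
    (Complex.I * ((((k : ℝ) - 1/2) * (-a - b) : ℝ) : ℂ))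
    ((-(s * ((d : ℝ) ^ 2 + (e : ℝ) ^ 2 - ((d : ℝ) + e) ^ 2 / 3)) : ℝ) : ℂ)
    (Complex.I * ((d * a + e * b : ℝ) : ℂ))
    ((-(3 * s * ((k : ℝ) - (1/2 - ((d + e : ℤ) : ℝ) / 3)) ^ 2) : ℝ) : ℂ)
    (Complex.I * ((((k : ℝ) - (1/2 - ((d + e : ℤ) : ℝ) / 3)) * 0 : ℝ) : ℂ))
    (by push_cast; ring)
  set U : ℂ := 3 ^ j * (((k : ℝ) - (1/2 - ((d + e : ℤ) : ℝ) / 3) : ℝ) : ℂ) ^ j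
  linear_combination (U * ((-1 : ℂ) ^ (d + k) * ((-1) ^ (e + k) * (-1) ^ k))) * this +
    U * (Complex.exp ((-(s * ((d : ℝ) ^ 2 + (e : ℝ) ^ 2 - ((d : ℝ) + e) ^ 2 / 3)) : ℝ) : ℂ) *
    Complex.exp (Complex.I * ((d * a + e * b : ℝ) : ℂ)) * (
    Complex.exp ((-(3 * s * ((k : ℝ) - (1/2 - ((d + e : ℤ) : ℝ) / 3)) ^ 2) : ℝ) : ℂ) *
    Complex.exp (Complex.I * ((((k : ℝ) - (1/2 - ((d + e : ℤ) : ℝ) / 3)) * 0 : ℝ) : ℂ)))) * hz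

lemma sum_shear (s a b : ℝ) (j : ℕ)
    (h : Summable (fun p : ℤ × ℤ × ℤ => (hf p.1 + hf p.2.1 + hf p.2.2) ^ j * base s a b (-a - b) p)) :
    ∑' p : ℤ × ℤ × ℤ, (hf p.1 + hf p.2.1 + hf p.2.2) ^ j * base s a b (-a - b) p =
    ∑' d : ℤ × ℤ, shC s a b d * 3 ^ j * W (1/2 - ((d.1 + d.2 : ℤ) : ℝ) / 3) j (3 * s) 0 := by
  rw [← shearEquiv.tsum_eq]
  have h' := (shearEquiv.summable_iff).mpr h
  refine h'.tsum_prod.trans ?_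
  refine tsum_congr fun d => ?_
  unfold W
  rw [← tsum_mul_left]
  exact tsum_congr fun k => base_shear s a b j d k

lemma three_term {s : ℝ} (hs : 0 < s) (a b c : ℝ) (habc : a + b + c = 0) :
    W (1/6) 0 (3 * s) 0 *
      (2 * (W (1/2) 1 s a * W (1/2) 1 s b * W (1/2) 0 s c +
        W (1/2) 1 s a * W (1/2) 0 s b * W (1/2) 1 s c +
        W (1/2) 0 s a * W (1/2) 1 s b * W (1/2) 1 s c) +
       (W (1/2) 2 s a * W (1/2) 0 s b * W (1/2) 0 s c +
        W (1/2) 0 s a * W (1/2) 2 s b * W (1/2) 0 s c +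
        W (1/2) 0 s a * W (1/2) 0 s b * W (1/2) 2 s c)) =
    9 * W (1/6) 2 (3 * s) 0 * (W (1/2) 0 s a * W (1/2) 0 s b * W (1/2) 0 s c) := by
  obtain rfl : c = -a - b := by linarith
  have T := triple_hasSum hs a b (-a - b)
  have h0 : HasSum (fun p : ℤ × ℤ × ℤ =>
      (hf p.1 + hf p.2.1 + hf p.2.2) ^ 0 * base s a b (-a - b) p) _ :=
    (T 0 0 0).congr_fun (fun p => by ring)
  have h2 : HasSum (fun p : ℤ × ℤ × ℤ =>
      (hf p.1 + hf p.2.1 + hf p.2.2) ^ 2 * base s a b (-a - b) p) _ :=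
    (((((T 1 1 0).add (T 1 0 1)).add (T 0 1 1)).mul_left 2).add
      (((T 2 0 0).add (T 0 2 0)).add (T 0 0 2))).congr_fun (fun p => by ring)
  rw [← h2.tsum_eq, ← h0.tsum_eq, sum_shear _ _ _ _ h2.summable, sum_shear _ _ _ _ h0.summable,
    ← tsum_mul_left, ← tsum_mul_left]
  refine tsum_congr fun d => ?_
  linear_combination (9 * shC s a b d) * W_ratio (d.1 + d.2) (3 * s)

lemma pent_real {x : ℝ} (hx0 : 0 < x) (hx1 : x < 1)
    (hS : Summable (fun k : ℤ => (-1 : ℝ) ^ k * x ^ pentagonal k)) :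
    ∏' n : ℕ, (1 - x ^ (n + 1)) = ∑' k : ℤ, (-1 : ℝ) ^ k * x ^ pentagonal k := by
  have hprod : ∀ k n : ℕ, 0 ≤ ∏ i ∈ Finset.range (n + 1), (1 - x ^ (k + i + 1)) ∧
      ∏ i ∈ Finset.range (n + 1), (1 - x ^ (k + i + 1)) ≤ 1 := by
    intro k n
    have h1 : ∀ i, 0 ≤ 1 - x ^ (k + i + 1) := fun i => by
      have := pow_le_one₀ hx0.le hx1.le (n := k + i + 1); linarith
    have h2 : ∀ i, 1 - x ^ (k + i + 1) ≤ 1 := fun i => by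
      have := pow_nonneg hx0.le (k + i + 1); linarith
    exact ⟨Finset.prod_nonneg fun i _ => h1 i, Finset.prod_le_one (fun i _ => h1 i) (fun i _ => h2 i)⟩
  have hgeo := summable_geometric_of_lt_one hx0.le hx1
  have hle : ∀ k n : ℕ, x ^ ((k + 1) * n) * ∏ i ∈ Finset.range (n + 1), (1 - x ^ (k + i + 1)) ≤ x ^ n := by
    intro k n
    calc _ ≤ x ^ ((k + 1) * n) * 1 := by gcongr; exact (hprod k n).2
      _ ≤ x ^ n := by
        rw [mul_one]
        exact pow_le_pow_of_le_one hx0.le hx1.le (by nlinarith)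
  have hnn : ∀ k n : ℕ, 0 ≤ x ^ ((k + 1) * n) * ∏ i ∈ Finset.range (n + 1), (1 - x ^ (k + i + 1)) :=
    fun k n => mul_nonneg (by positivity) (hprod k n).1
  have hsum : ∀ k : ℕ, Summable
      (fun n : ℕ ↦ x ^ ((k + 1) * n) * ∏ i ∈ Finset.range (n + 1), (1 - x ^ (k + i + 1))) :=
    fun k => Summable.of_nonneg_of_le (hnn k) (hle k) hgeo
  have hS' : Summable (fun k : ℤ => (-1 : ℝ) ^ (-k) * x ^ pentagonal (-k)) :=
    (Equiv.neg ℤ).summable_iff.mpr hS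
  have hS1 : Summable (fun k : ℕ => (-1 : ℝ) ^ k * x ^ pentagonal (-k)) := by
    have := hS'.comp_injective Nat.cast_injective
    refine this.congr fun k => ?_
    simp [zpow_neg, ← inv_pow]
  have hS2 : Summable (fun k : ℕ => (-1 : ℝ) ^ (k + 1) * x ^ pentagonal (k + 1)) := by
    have hi : Function.Injective (fun n : ℕ => (n : ℤ) + 1) := fun a b h => by simpa using h
    have := hS.comp_injective hi
    refine this.congr fun k => ?_
    simp only [Function.comp]; norm_cast
  have key := Pentagonal.tprod_one_sub_pow (x := x)
    (tendsto_pow_atTop_nhds_zero_of_lt_one hx0.le hx1) hsum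
    (fun k => by
      have : Summable (fun n : ℕ => ‖-x ^ (n + k + 1)‖) := by
        simp_rw [norm_neg, norm_pow, Real.norm_of_nonneg hx0.le]
        simp_rw [add_assoc]
        exact (summable_nat_add_iff (k + 1)).mpr hgeo
      simpa [sub_eq_add_neg] using multipliable_one_add_of_summable this)
    ((hS1.add hS2).congr fun k => by ring)
    (by
      refine squeeze_zero_norm (a := fun k => x ^ k * (1 - x)⁻¹) (fun k => ?_) ?_
      · have h1 : ∑' (n : ℕ), x ^ ((k + 1) * n) * ∏ i ∈ Finset.range (n + 1), (1 - x ^ (k + i + 1)) ≤ (1 - x)⁻¹ := by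
          rw [← tsum_geometric_of_lt_one hx0.le hx1]
          exact (hsum k).tsum_le_tsum (hle k) hgeo
        have h2 : 0 ≤ ∑' (n : ℕ), x ^ ((k + 1) * n) * ∏ i ∈ Finset.range (n + 1), (1 - x ^ (k + i + 1)) :=
          tsum_nonneg (hnn k)
        rw [norm_mul, norm_mul, norm_pow, norm_neg, norm_one, one_pow, one_mul, norm_pow,
          Real.norm_of_nonneg hx0.le, Real.norm_of_nonneg h2]
        gcongr ?_ * ?_
        refine pow_le_pow_of_le_one hx0.le hx1.le ?_
        rw [Nat.le_div_iff_mul_le (by norm_num)]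
        nlinarith
      · simpa using (tendsto_pow_atTop_nhds_zero_of_lt_one hx0.le hx1).mul_const (1 - x)⁻¹)
  rw [key]
  have e : ∑' k : ℤ, (-1 : ℝ) ^ k * x ^ pentagonal k = ∑' k : ℤ, (-1 : ℝ) ^ (-k) * x ^ pentagonal (-k) :=
    ((Equiv.neg ℤ).tsum_eq _).symm
  rw [e, ← (hS'.hasSum.nat_add_neg_add_one).tsum_eq]
  refine tsum_congr fun k => ?_
  have a1 : (-1 : ℝ) ^ (-(k : ℤ)) = (-1) ^ k := by simp [zpow_neg, ← inv_pow]
  have a2 : (-1 : ℝ) ^ (-(-((k : ℤ) + 1))) = (-1) ^ (k + 1) := by rw [neg_neg]; norm_cast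
  rw [a1, a2, neg_neg]; ring

lemma tprod_ne {x : ℝ} (hx0 : 0 < x) (hx1 : x < 1) : ∏' n : ℕ, (1 - x ^ (n + 1)) ≠ 0 := by
  simp_rw [sub_eq_add_neg]
  refine tprod_one_add_ne_zero_of_summable (f := fun n : ℕ => -x ^ (n + 1)) (fun n => ?_) ?_
  · have := pow_lt_one₀ hx0.le hx1 (n := n + 1) (by omega)
    linarith
  · simp_rw [norm_neg, norm_pow, Real.norm_of_nonneg hx0.le]
    exact (summable_nat_add_iff 1).mpr (summable_geometric_of_lt_one hx0.le hx1)

lemma eta_W {S : ℝ} (hS : 0 < S) :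
    ((Real.exp (-S / 36) * ∏' n : ℕ, (1 - Real.exp (-(((n : ℝ) + 1) * (2 * S / 3)))) : ℝ) : ℂ) =
      W (1/6) 0 S 0 ∧
    W (1/6) 0 S 0 ≠ 0 := by
  set x : ℝ := Real.exp (-(2 * S / 3)) with hx
  have hx0 : 0 < x := Real.exp_pos _
  have hx1 : x < 1 := by
    rw [hx, ← Real.exp_zero]; exact Real.exp_lt_exp.mpr (by linarith)
  have hpow : ∀ n : ℕ, Real.exp (-(((n : ℝ) + 1) * (2 * S / 3))) = x ^ (n + 1) := by
    intro n
    rw [hx, ← Real.exp_nat_mul]; congr 1; push_cast; ring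
  simp_rw [hpow]
  have hw : ∀ k : ℤ, wt (1/6) 0 S 0 k =
      ((Real.exp (-S / 36) * ((-1 : ℝ) ^ k * x ^ pentagonal k) : ℝ) : ℂ) := by
    intro k
    have h2 : (2 * (pentagonal k : ℝ)) = k * (3 * k - 1) := by
      exact_mod_cast two_mul_natCast_pentagonal k
    have h1 : Real.exp (-(S * ((k : ℝ) - 1/6) ^ 2)) = Real.exp (-S / 36) * x ^ pentagonal k := by
      rw [hx, ← Real.exp_nat_mul, ← Real.exp_add]; congr 1
      linear_combination (S / 3) * h2
    unfold wt
    rw [← Complex.ofReal_exp, h1]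
    push_cast
    simp
    ring
  have hsum : Summable (fun k : ℤ => (-1 : ℝ) ^ k * x ^ pentagonal k) := by
    have h := summable_wt (1/6) 0 hS 0
    rw [funext hw, Complex.summable_ofReal] at h
    exact (summable_mul_left_iff (Real.exp_ne_zero _)).mp h
  have e : ((Real.exp (-S / 36) * ∏' n : ℕ, (1 - x ^ (n + 1)) : ℝ) : ℂ) = W (1/6) 0 S 0 := by
    unfold W
    rw [pent_real hx0 hx1 hsum, ← tsum_mul_left, Complex.ofReal_tsum]
    exact tsum_congr fun k => (hw k).symm
  refine ⟨e, ?_⟩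
  rw [← e, Complex.ofReal_ne_zero]
  exact mul_ne_zero (Real.exp_ne_zero _) (tprod_ne hx0 hx1)

def PP (N : ℕ) : Finset (Fin N × Fin N) := Finset.univ.filter (fun p => p.1 < p.2)

noncomputable def ee {N : ℕ} (i : Fin N) (p : Fin N × Fin N) : ℂ :=
  (if i = p.2 then 1 else 0) - (if i = p.1 then 1 else 0)

noncomputable def Tr {N : ℕ} (φ : Fin N → Fin N → Fin N → ℂ) : ℂ :=
  ∑ a, ∑ b, ∑ c, if a < b ∧ b < c then φ a b c else 0

lemma sum_ee {N : ℕ} (p : Fin N × Fin N) : ∑ i, ee i p = 0 := by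
  simp [ee]

lemma sum_ee_mul {N : ℕ} (p q : Fin N × Fin N) : ∑ i, ee i p * ee i q =
    (if p.2 = q.2 then 1 else 0) + (if p.1 = q.1 then 1 else 0)
     - (if p.2 = q.1 then 1 else 0) - (if p.1 = q.2 then 1 else 0) := by
  simp [ee, mul_sub, Finset.sum_sub_distrib]
  simp only [eq_comm (a := q.2), eq_comm (a := q.1)]
  ring

lemma sum_ee_sq {N : ℕ} (p : Fin N × Fin N) (hp : p ∈ PP N) : ∑ i, ee i p ^ 2 = 2 := by
  have h : p.1 < p.2 := by simpa [PP] using hp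
  simp_rw [sq]
  rw [sum_ee_mul]
  simp [h.ne, h.ne']
  norm_num

lemma sum_PP {N : ℕ} (Y : Fin N × Fin N → ℂ) :
    ∑ p ∈ PP N, Y p = ∑ a, ∑ b, if a < b then Y (a, b) else 0 := by
  rw [PP, Finset.sum_filter, Fintype.sum_prod_type]

lemma sum_pairs {N : ℕ} (X : Fin N × Fin N → Fin N × Fin N → ℂ)
    (hsym : ∀ p q, X p q = X q p) (h0 : ∀ p, X p p = 0) :
    ∑ p ∈ PP N, ∑ q ∈ PP N, (∑ i, ee i p * ee i q) * X p q =
      2 * Tr (fun a b c => X (a, c) (b, c) + X (a, b) (a, c) - X (a, b) (b, c)) := by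
  set F : Fin N → Fin N → Fin N → Fin N → ℂ :=
    fun a b c d => if a < b ∧ c < d then X (a, b) (c, d) else 0 with hF
  have e1 : ∑ p ∈ PP N, ∑ q ∈ PP N, (∑ i, ee i p * ee i q) * X p q =
      ∑ a, ∑ b, ∑ c, ∑ d, ((if b = d then 1 else 0) + (if a = c then 1 else 0)
        - (if b = c then 1 else 0) - (if a = d then 1 else 0)) * F a b c d := by
    simp_rw [sum_PP, sum_ee_mul]
    refine Finset.sum_congr rfl fun a _ => Finset.sum_congr rfl fun b _ => ?_
    by_cases hab : a < b
    · rw [if_pos hab]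
      refine Finset.sum_congr rfl fun c _ => Finset.sum_congr rfl fun d _ => ?_
      by_cases hcd : c < d <;> simp [hF, hab, hcd]
    · simp [hF, hab]
  have e2 : ∑ a, ∑ b, ∑ c, ∑ d, ((if b = d then 1 else 0) + (if a = c then 1 else 0)
        - (if b = c then 1 else 0) - (if a = d then 1 else 0)) * F a b c d =
      ∑ a, ∑ b, ∑ c, F a b c b + ∑ a, ∑ b, ∑ d, F a b a d
       - ∑ a, ∑ b, ∑ d, F a b b d - ∑ a, ∑ b, ∑ c, F a b c a := by
    simp_rw [← Finset.sum_add_distrib, ← Finset.sum_sub_distrib]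
    refine Finset.sum_congr rfl fun a _ => Finset.sum_congr rfl fun b _ => ?_
    simp_rw [sub_mul, add_mul, Finset.sum_sub_distrib, Finset.sum_add_distrib]
    congr 1
    · congr 1
      · congr 1
        · simp
        · rw [Finset.sum_comm]; simp
      · rw [Finset.sum_comm]; simp
    · simp
  have t1 : ∑ a, ∑ b, ∑ c, F a b c b = 2 * Tr (fun a b c => X (a, c) (b, c)) := by
    have : ∀ a b c, F a b c b = (if a < c ∧ c < b then X (a, b) (c, b) else 0) +
        (if c < a ∧ a < b then X (c, b) (a, b) else 0) := by
      intro a b c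
      rw [hsym (c, b)]
      rcases lt_trichotomy a c with h | h | h
      · by_cases h2 : c < b
        · simp [hF, h, h2, h.trans h2, h.not_gt]
        · simp [hF, h2, h.not_gt]
      · subst h; simp [hF, h0]
      · by_cases h2 : a < b
        · simp [hF, h, h2, h.trans h2, h.not_gt]
        · simp [hF, h2, h.not_gt]
    simp_rw [this, Finset.sum_add_distrib, two_mul]
    unfold Tr
    congr 1
    · exact Finset.sum_congr rfl fun a _ => Finset.sum_comm
    · rw [Finset.sum_congr rfl fun a _ => Finset.sum_comm, Finset.sum_comm]
  have t2 : ∑ a, ∑ b, ∑ d, F a b a d = 2 * Tr (fun a b c => X (a, b) (a, c)) := by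
    have : ∀ a b c, F a b a c = (if a < b ∧ b < c then X (a, b) (a, c) else 0) +
        (if a < c ∧ c < b then X (a, c) (a, b) else 0) := by
      intro a b c
      rw [hsym (a, c)]
      rcases lt_trichotomy b c with h | h | h
      · by_cases h2 : a < b
        · simp [hF, h, h2, h2.trans h, h.not_gt]
        · simp [hF, h2, h.not_gt]
      · subst h; simp [hF, h0]
      · by_cases h2 : a < c
        · simp [hF, h, h2, h2.trans h, h.not_gt]
        · simp [hF, h2, h.not_gt]
    simp_rw [this, Finset.sum_add_distrib, two_mul]
    unfold Tr
    congr 1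
    exact Finset.sum_congr rfl fun a _ => Finset.sum_comm
  have t3 : ∑ a, ∑ b, ∑ d, F a b b d = Tr (fun a b c => X (a, b) (b, c)) := rfl
  have t4 : ∑ a, ∑ b, ∑ c, F a b c a = Tr (fun a b c => X (a, b) (b, c)) := by
    have : ∀ a b c, F a b c a = (if c < a ∧ a < b then X (c, a) (a, b) else 0) := by
      intro a b c
      rw [hsym (c, a)]
      simp only [hF, and_comm]
    simp_rw [this]
    unfold Tr
    rw [Finset.sum_congr rfl fun a _ => Finset.sum_comm, Finset.sum_comm]
  have t5 : Tr (fun a b c => X (a, c) (b, c) + X (a, b) (a, c) - X (a, b) (b, c)) =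
      Tr (fun a b c => X (a, c) (b, c)) + Tr (fun a b c => X (a, b) (a, c))
       - Tr (fun a b c => X (a, b) (b, c)) := by
    unfold Tr
    simp_rw [← Finset.sum_add_distrib, ← Finset.sum_sub_distrib]
    refine Finset.sum_congr rfl fun a _ => Finset.sum_congr rfl fun b _ =>
      Finset.sum_congr rfl fun c _ => ?_
    split_ifs <;> simp
  rw [e1, e2, t1, t2, t3, t4, t5]; ring

lemma count_pairs {N : ℕ} (Y : Fin N × Fin N → ℂ) :
    Tr (fun a b c => Y (a, b) + Y (b, c) + Y (a, c)) = ((N : ℂ) - 2) * ∑ p ∈ PP N, Y p := by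
  have e : Tr (fun a b c => Y (a, b) + Y (b, c) + Y (a, c)) =
      ∑ a, ∑ b, ∑ c, ((if a < b ∧ b < c then Y (a, b) else 0) +
        (if c < a ∧ a < b then Y (a, b) else 0) + (if a < c ∧ c < b then Y (a, b) else 0)) := by
    simp_rw [Finset.sum_add_distrib]
    have h1 : ∑ a : Fin N, ∑ b, ∑ c, (if c < a ∧ a < b then Y (a, b) else 0) =
        ∑ a, ∑ b, ∑ c, (if a < b ∧ b < c then Y (b, c) else 0) := by
      rw [Finset.sum_congr rfl fun a _ => Finset.sum_comm, Finset.sum_comm]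
    have h2 : ∑ a : Fin N, ∑ b, ∑ c, (if a < c ∧ c < b then Y (a, b) else 0) =
        ∑ a, ∑ b, ∑ c, (if a < b ∧ b < c then Y (a, c) else 0) :=
      Finset.sum_congr rfl fun a _ => Finset.sum_comm
    rw [h1, h2]
    unfold Tr
    simp_rw [← Finset.sum_add_distrib]
    refine Finset.sum_congr rfl fun a _ => Finset.sum_congr rfl fun b _ =>
      Finset.sum_congr rfl fun c _ => ?_
    split_ifs <;> simp
  rw [e, sum_PP, Finset.mul_sum]
  refine Finset.sum_congr rfl fun a _ => ?_
  rw [Finset.mul_sum]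
  refine Finset.sum_congr rfl fun b _ => ?_
  by_cases hab : a < b
  · have : ∀ c, ((if a < b ∧ b < c then Y (a, b) else 0) +
        (if c < a ∧ a < b then Y (a, b) else 0) + (if a < c ∧ c < b then Y (a, b) else 0)) =
        Y (a, b) - (if a = c then Y (a, b) else 0) - (if b = c then Y (a, b) else 0) := by
      intro c
      rcases lt_trichotomy a c with h | h | h
      · rcases lt_trichotomy b c with h2 | h2 | h2
        · simp [hab, h, h2, h.ne, h2.ne, h.not_gt, h2.not_gt]
        · subst h2; simp [hab, hab.ne, h.not_gt]
        · simp [hab, h, h2, h.ne, h2.ne', h.not_gt, h2.not_gt]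
      · subst h; simp [hab, hab.ne', hab.not_gt]
      · have h2 := h.trans hab
        simp [hab, h, h.ne', h2.ne', h.not_gt, h2.not_gt]
    simp_rw [this, Finset.sum_sub_distrib]
    simp [hab]; ring
  · have : ∀ x, ¬(a < x ∧ x < b) := fun x h => hab (h.1.trans h.2)
    simp [hab, this]

lemma card_PP (N : ℕ) : 2 * ∑ p ∈ PP N, (1 : ℂ) = N * (N - 1) := by
  have h1 := sum_PP (N := N) (fun _ => 1)
  have h2 := h1
  rw [Finset.sum_comm] at h2
  rw [two_mul]
  nth_rewrite 1 [h2]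
  rw [h1, ← Finset.sum_add_distrib]
  have : ∀ a : Fin N, (∑ b, if b < a then (1 : ℂ) else 0) + ∑ b, (if a < b then (1 : ℂ) else 0) = N - 1 := by
    intro a
    rw [← Finset.sum_add_distrib]
    have : ∀ b, ((if b < a then (1 : ℂ) else 0) + (if a < b then (1 : ℂ) else 0)) =
      1 - (if a = b then 1 else 0) := by
      intro b
      rcases lt_trichotomy a b with h | h | h
      · simp [h, h.ne, h.not_gt]
      · simp [h]
      · simp [h, h.ne', h.not_gt]
    simp_rw [this, Finset.sum_sub_distrib]; simp
  simp_rw [this]; simp; ring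

lemma card_Tr (N : ℕ) (hN : 2 ≤ N) : 3 * Tr (N := N) (fun _ _ _ => 1) = N * (((N - 1) * (N - 2) / 2 : ℕ) : ℂ) := by
  have h := count_pairs (N := N) (fun _ => 1)
  have h2 : Tr (N := N) (fun _ _ _ => (1 + 1 + 1 : ℂ)) = 3 * Tr (N := N) (fun _ _ _ => 1) := by
    unfold Tr
    simp_rw [Finset.mul_sum]
    refine Finset.sum_congr rfl fun a _ => Finset.sum_congr rfl fun b _ =>
      Finset.sum_congr rfl fun c _ => ?_
    split_ifs <;> norm_num
  have h3 : (2 : ℂ) * (((N - 1) * (N - 2) / 2 : ℕ) : ℂ) = (N - 1) * (N - 2) := by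
    obtain ⟨m, rfl⟩ : ∃ m, N = m + 2 := ⟨N - 2, by omega⟩
    have hd : 2 ∣ (m + 2 - 1) * (m + 2 - 2) := by
      have := Nat.even_mul_succ_self m
      rw [mul_comm]; exact this.two_dvd
    have := Nat.mul_div_cancel' hd
    have h4 : ((2 * ((m + 2 - 1) * (m + 2 - 2) / 2) : ℕ) : ℂ) = ((m + 2 - 1) * (m + 2 - 2) : ℕ) := by rw [this]
    rw [Nat.cast_mul] at h4
    rw [Nat.cast_ofNat] at h4
    rw [h4]; push_cast; ring
  rw [h2] at h
  have h5 := card_PP N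
  linear_combination h + ((N : ℂ) - 2) / 2 * h5 - N / 2 * h3

lemma comb {N : ℕ} (hN : 2 ≤ N) (f g h : Fin N × Fin N → ℂ) (E E2 : ℂ)
    (H : ∀ a b c : Fin N, a < b → b < c →
      E * (2 * (g (a, c) * g (b, c) * f (a, b) + g (a, b) * g (a, c) * f (b, c)
          - g (a, b) * g (b, c) * f (a, c))) =
      E * (h (a, b) * f (b, c) * f (a, c) + f (a, b) * h (b, c) * f (a, c)
         + f (a, b) * f (b, c) * h (a, c)) - 9 * E2 * (f (a, b) * f (b, c) * f (a, c))) :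
    E * ∑ p ∈ PP N, ∑ q ∈ (PP N).erase p, (∑ i, ee i p * ee i q) *
        (g p * g q * ∏ w ∈ ((PP N).erase p).erase q, f w) =
      E * (((N : ℂ) - 2) * ∑ p ∈ PP N, h p * ∏ w ∈ (PP N).erase p, f w)
      - 3 * E2 * (N * (((N - 1) * (N - 2) / 2 : ℕ) : ℂ)) * ∏ w ∈ PP N, f w := by
  set X : Fin N × Fin N → Fin N × Fin N → ℂ := fun p q =>
    if p = q then 0 else g p * g q * ∏ w ∈ ((PP N).erase p).erase q, f w with hX
  have e1 : ∑ p ∈ PP N, ∑ q ∈ (PP N).erase p, (∑ i, ee i p * ee i q) *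
        (g p * g q * ∏ w ∈ ((PP N).erase p).erase q, f w) =
      ∑ p ∈ PP N, ∑ q ∈ PP N, (∑ i, ee i p * ee i q) * X p q := by
    refine Finset.sum_congr rfl fun p hp => ?_
    rw [← Finset.add_sum_erase (PP N) _ hp]
    have : X p p = 0 := by simp [hX]
    rw [this, mul_zero, zero_add]
    refine Finset.sum_congr rfl fun q hq => ?_
    have hne : p ≠ q := (Finset.ne_of_mem_erase hq).symm
    simp [hX, hne]
  have hX0 : ∀ p, X p p = 0 := fun p => if_pos rfl
  rw [e1, sum_pairs X ?_ hX0, ← count_pairs, ← card_Tr N hN]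
  · unfold Tr
    simp_rw [Finset.mul_sum, Finset.sum_mul, ← Finset.sum_sub_distrib]
    refine Finset.sum_congr rfl fun a _ => Finset.sum_congr rfl fun b _ =>
      Finset.sum_congr rfl fun c _ => ?_
    by_cases habc : a < b ∧ b < c
    · obtain ⟨hab, hbc⟩ := habc
      have hac := hab.trans hbc
      simp only [hab, hbc, and_self, if_true]
      have n1 : ((a, c) : Fin N × Fin N) ≠ (b, c) := by simp [hab.ne]
      have n2 : ((a, b) : Fin N × Fin N) ≠ (a, c) := by simp [hbc.ne]
      have n3 : ((a, b) : Fin N × Fin N) ≠ (b, c) := by simp [hab.ne]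
      have m1 : ((a, b) : Fin N × Fin N) ∈ PP N := by simp [PP, hab]
      have m2 : ((b, c) : Fin N × Fin N) ∈ PP N := by simp [PP, hbc]
      have m3 : ((a, c) : Fin N × Fin N) ∈ PP N := by simp [PP, hac]
      set R := ∏ w ∈ (((PP N).erase (a, b)).erase (b, c)).erase (a, c), f w with hR
      have r1 : ∏ w ∈ ((PP N).erase (a, b)).erase (b, c), f w = f (a, c) * R :=
        (Finset.mul_prod_erase _ f (by simp [m3, n1, n2.symm])).symm
      have r2 : ∏ w ∈ ((PP N).erase (a, b)).erase (a, c), f w = f (b, c) * R := by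
        rw [hR, Finset.erase_right_comm (a := (b, c))]
        exact (Finset.mul_prod_erase _ f (by simp [m2, n1.symm, n3.symm])).symm
      have r3 : ∏ w ∈ ((PP N).erase (a, c)).erase (b, c), f w = f (a, b) * R := by
        rw [hR, Finset.erase_right_comm (a := (a, b)), Finset.erase_right_comm (a := (a, b)), Finset.erase_right_comm (a := (b, c))]
        exact (Finset.mul_prod_erase _ f (by simp [m1, n2, n3])).symm
      have s1 : ∏ w ∈ (PP N).erase (a, b), f w = f (b, c) * (f (a, c) * R) := by
        rw [← r1]; exact (Finset.mul_prod_erase _ f (by simp [m2, n3.symm])).symm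
      have s2 : ∏ w ∈ (PP N).erase (b, c), f w = f (a, b) * (f (a, c) * R) := by
        rw [← r1, Finset.erase_right_comm]; exact (Finset.mul_prod_erase _ f (by simp [m1, n3])).symm
      have s3 : ∏ w ∈ (PP N).erase (a, c), f w = f (a, b) * (f (b, c) * R) := by
        rw [← r2, Finset.erase_right_comm]; exact (Finset.mul_prod_erase _ f (by simp [m1, n2])).symm
      have s4 : ∏ w ∈ PP N, f w = f (a, b) * (f (b, c) * (f (a, c) * R)) := by
        rw [← s1]; exact (Finset.mul_prod_erase _ f m1).symm
      simp only [hX, n1, n2, n3, if_false, r1, r2, r3, s1, s2, s3, s4]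
      linear_combination R * H a b c hab hbc
    · simp [habc]
  · intro p q
    simp only [hX]
    by_cases h : p = q
    · simp [h]
    · rw [if_neg h, if_neg (Ne.symm h), Finset.erase_right_comm]; ring

lemma theta1_W (N : ℕ) {r : ℝ} (hr : 0 < r) (s y : ℝ) :
    theta1 (((y / (2 * Real.pi * r) : ℝ)) : ℂ) (Complex.I * N * s / (2 * Real.pi * r ^ 2)) =
      Complex.I * W (1/2) 0 (N / (2 * r ^ 2) * s) (y / r) := by
  unfold theta1 W
  congr 1
  refine tsum_congr fun n => ?_
  unfold wt
  have hpi : (Real.pi : ℂ) ≠ 0 := by exact_mod_cast Real.pi_ne_zero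
  have hr' : (r : ℂ) ≠ 0 := by exact_mod_cast hr.ne'
  have h1 : (Real.pi * Complex.I * (Complex.I * N * s / (2 * Real.pi * r ^ 2)) * ((n : ℂ) - 1 / 2) ^ 2) =
      ((-(N / (2 * r ^ 2) * s * ((n : ℝ) - 1 / 2) ^ 2) : ℝ) : ℂ) := by
    push_cast
    field_simp
    rw [Complex.I_sq]; ring
  have h2 : (Real.pi * Complex.I * (2 * (n : ℂ) - 1) * ((y / (2 * Real.pi * r) : ℝ) : ℂ)) =
      Complex.I * ((((n : ℝ) - 1 / 2) * (y / r) : ℝ) : ℂ) := by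
    push_cast
    field_simp
  rw [pow_zero, mul_one, h1, h2]

noncomputable def KK (N : ℕ) (r tstar : ℝ) : ℂ :=
  ((Real.exp (-((N : ℝ) * ((N : ℝ) - 1) * ((N : ℝ) - 2) * tstar) / (48 * r ^ 2)) : ℝ) : ℂ) *
    (Complex.I * ∏ _p ∈ PP N, Complex.I)

lemma hA_eq (N : ℕ) (hN : 2 ≤ N) {r : ℝ} (tstar δ : ℝ) (hr : 0 < r) {s : ℝ} (hs : 0 < s)
    (x : Fin N → ℝ) :
    hA N r tstar δ s x = KK N r tstar *
      (W (1/6) 0 (3 * (N / (2 * r ^ 2) * s)) 0) ^ (-((((N - 1) * (N - 2) / 2 : ℕ)) : ℤ)) *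
      W (1/2) 0 (N / (2 * r ^ 2) * s) ((δ + ∑ j, x j) / r) *
      ∏ p ∈ PP N, W (1/2) 0 (N / (2 * r ^ 2) * s) ((x p.2 - x p.1) / r) := by
  have hN0 : (0 : ℝ) < N := by exact_mod_cast (by omega : 0 < N)
  have hS : 0 < 3 * (N / (2 * r ^ 2) * s) := by positivity
  unfold hA
  rw [theta1_W N hr]
  have e1 : Real.exp (-((N : ℝ) * s) / (24 * r ^ 2)) *
        ∏' n : ℕ, (1 - Real.exp (-(((n : ℝ) + 1) * N * s) / r ^ 2)) =
      Real.exp (-(3 * (N / (2 * r ^ 2) * s)) / 36) * ∏' n : ℕ,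
        (1 - Real.exp (-(((n : ℝ) + 1) * (2 * (3 * (N / (2 * r ^ 2) * s)) / 3)))) := by
    congr 1
    · congr 1; field_simp; ring
    · refine tprod_congr fun n => ?_
      congr 2; field_simp
  rw [e1, (eta_W hS).1]
  have e2 : (∏ j : Fin N, ∏ k : Fin N, if j < k then
      theta1 ((((x k - x j) / (2 * Real.pi * r) : ℝ)) : ℂ)
        (Complex.I * N * s / (2 * Real.pi * r ^ 2)) else 1) =
      (∏ _p ∈ PP N, Complex.I) *
        ∏ p ∈ PP N, W (1/2) 0 (N / (2 * r ^ 2) * s) ((x p.2 - x p.1) / r) := by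
    rw [← Finset.prod_mul_distrib, PP, Finset.prod_filter, Fintype.prod_prod_type]
    refine Finset.prod_congr rfl fun j _ => Finset.prod_congr rfl fun k _ => ?_
    split_ifs
    · rw [theta1_W N hr]
    · rfl
  rw [e2, KK]
  ring

lemma prod_second {ι : Type*} [DecidableEq ι] (P : Finset ι) (A0 A1 A2 : ι → ℝ → ℂ) (θ0 θ1 θ2 : ℝ → ℂ)
    (k : ℂ)
    (h0 : ∀ p a, HasDerivAt (A0 p) (A1 p a) a) (h1 : ∀ p a, HasDerivAt (A1 p) (A2 p a) a)
    (t0 : ∀ a, HasDerivAt θ0 (θ1 a) a) (t1 : ∀ a, HasDerivAt θ1 (θ2 a) a) (a : ℝ) :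
    iteratedDeriv 2 (fun a => k * θ0 a * ∏ p ∈ P, A0 p a) a =
      k * (θ2 a * ∏ p ∈ P, A0 p a + 2 * θ1 a * ∑ p ∈ P, (∏ q ∈ P.erase p, A0 q a) * A1 p a
        + θ0 a * ∑ p ∈ P, ((∑ q ∈ P.erase p, (∏ w ∈ (P.erase p).erase q, A0 w a) * A1 q a) * A1 p a
          + (∏ q ∈ P.erase p, A0 q a) * A2 p a)) := by
  have hp : ∀ (Q : Finset ι) a, HasDerivAt (fun a => ∏ p ∈ Q, A0 p a)
      (∑ p ∈ Q, (∏ q ∈ Q.erase p, A0 q a) * A1 p a) a := by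
    intro Q a
    simpa only [smul_eq_mul] using HasDerivAt.fun_finsetProd (u := Q) (f := A0) (f' := fun p => A1 p a) (x := a) (fun p _ => h0 p a)
  have d1 : deriv (fun a => k * θ0 a * ∏ p ∈ P, A0 p a) = fun a =>
      k * θ1 a * ∏ p ∈ P, A0 p a + k * θ0 a * ∑ p ∈ P, (∏ q ∈ P.erase p, A0 q a) * A1 p a := by
    funext a
    exact (((t0 a).const_mul k).mul (hp P a)).deriv
  rw [iteratedDeriv_succ, iteratedDeriv_one, d1]
  have hs : HasDerivAt (fun a => ∑ p ∈ P, (∏ q ∈ P.erase p, A0 q a) * A1 p a)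
      (∑ p ∈ P, ((∑ q ∈ P.erase p, (∏ w ∈ (P.erase p).erase q, A0 w a) * A1 q a) * A1 p a
          + (∏ q ∈ P.erase p, A0 q a) * A2 p a)) a :=
    HasDerivAt.fun_sum fun p _ => (hp (P.erase p) a).mul (h1 p a)
  refine ((((t1 a).const_mul k).mul (hp P a)).add (((t0 a).const_mul k).mul hs)).deriv.trans ?_
  ring

lemma W_affine (c : ℝ) (j : ℕ) {s : ℝ} (hs : 0 < s) (y : ℝ → ℝ) (m : ℝ)
    (hy : ∀ a, HasDerivAt y m a) (a : ℝ) :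
    HasDerivAt (fun a => W c j s (y a)) (Complex.I * m * W c (j + 1) s (y a)) a := by
  have := (W_deriv_y c j hs (y a)).scomp a (hy a)
  refine this.congr_deriv ?_
  rw [Complex.real_smul]; ring

lemma upd_deriv {N : ℕ} (x : Fin N → ℝ) (i j : Fin N) (a : ℝ) :
    HasDerivAt (fun a => Function.update x i a j) (if i = j then 1 else 0) a := by
  by_cases h : i = j
  · subst h; simp only [Function.update_self, if_true]; exact hasDerivAt_id a
  · simp only [Function.update_of_ne (Ne.symm h), if_neg h]; exact hasDerivAt_const _ _

noncomputable def er {N : ℕ} (i : Fin N) (p : Fin N × Fin N) : ℝ :=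
  (if i = p.2 then 1 else 0) - (if i = p.1 then 1 else 0)

lemma er_cast {N : ℕ} (i : Fin N) (p : Fin N × Fin N) : ((er i p : ℝ) : ℂ) = ee i p := by
  unfold er ee; split_ifs <;> simp

lemma W_triple {S : ℝ} (hS : 0 < S) (a b c : ℝ) (h : c = a + b) :
    W (1/6) 0 (3 * S) 0 * (2 * (W (1/2) 1 S c * W (1/2) 1 S b * W (1/2) 0 S a
       + W (1/2) 1 S a * W (1/2) 1 S c * W (1/2) 0 S b
          - W (1/2) 1 S a * W (1/2) 1 S b * W (1/2) 0 S c)) =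
      W (1/6) 0 (3 * S) 0 * (W (1/2) 2 S a * W (1/2) 0 S b * W (1/2) 0 S c
         + W (1/2) 0 S a * W (1/2) 2 S b * W (1/2) 0 S c
         + W (1/2) 0 S a * W (1/2) 0 S b * W (1/2) 2 S c)
       - 9 * W (1/6) 2 (3 * S) 0 * (W (1/2) 0 S a * W (1/2) 0 S b * W (1/2) 0 S c) := by
  have T := three_term hS a b (-c) (by linarith)
  rw [W_refl 0, W_refl 1, W_refl 2] at T
  linear_combination T

lemma space_part (N : ℕ) {r : ℝ} (hr : 0 < r) (δ : ℝ) {S : ℝ} (hS : 0 < S) (k : ℂ)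
    (x : Fin N → ℝ) (i : Fin N) (f g h : Fin N × Fin N → ℂ)
    (hf : ∀ p, f p = W (1/2) 0 S ((x p.2 - x p.1) / r))
    (hg : ∀ p, g p = W (1/2) 1 S ((x p.2 - x p.1) / r))
    (hh : ∀ p, h p = W (1/2) 2 S ((x p.2 - x p.1) / r)) :
    iteratedDeriv 2 (fun a : ℝ => k * W (1/2) 0 S ((δ + ∑ j, Function.update x i a j) / r) *
      ∏ p ∈ PP N, W (1/2) 0 S ((Function.update x i a p.2 - Function.update x i a p.1) / r)) (x i) =
    -k / r ^ 2 * (W (1/2) 2 S ((δ + ∑ j, x j) / r) * ∏ p ∈ PP N, f p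
      + 2 * W (1/2) 1 S ((δ + ∑ j, x j) / r) * ∑ p ∈ PP N, ee i p * (g p * ∏ q ∈ (PP N).erase p, f q)
      + W (1/2) 0 S ((δ + ∑ j, x j) / r) *
        (∑ p ∈ PP N, ∑ q ∈ (PP N).erase p, ee i p * ee i q *
          (g p * g q * ∏ w ∈ ((PP N).erase p).erase q, f w)
        + ∑ p ∈ PP N, ee i p ^ 2 * (h p * ∏ q ∈ (PP N).erase p, f q))) := by
  have hr' : (r : ℂ) ≠ 0 := by exact_mod_cast hr.ne'
  have hy : ∀ (p : Fin N × Fin N) a, HasDerivAt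
      (fun a => (Function.update x i a p.2 - Function.update x i a p.1) / r) (er i p / r) a :=
    fun p a => ((upd_deriv x i p.2 a).sub (upd_deriv x i p.1 a)).div_const r
  have hz : ∀ a, HasDerivAt (fun a => (δ + ∑ j, Function.update x i a j) / r) (1 / r) a := by
    intro a
    have h1 := HasDerivAt.fun_sum (u := Finset.univ) (fun j _ => upd_deriv x i j a)
    have h2 := (h1.const_add δ).div_const r
    simpa using h2
  rw [prod_second (PP N)
    (fun p a => W (1/2) 0 S ((Function.update x i a p.2 - Function.update x i a p.1) / r))
    (fun p a => Complex.I * ((er i p / r : ℝ) : ℂ) *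
      W (1/2) 1 S ((Function.update x i a p.2 - Function.update x i a p.1) / r))
    (fun p a => Complex.I * ((er i p / r : ℝ) : ℂ) * (Complex.I * ((er i p / r : ℝ) : ℂ) *
      W (1/2) 2 S ((Function.update x i a p.2 - Function.update x i a p.1) / r)))
    (fun a => W (1/2) 0 S ((δ + ∑ j, Function.update x i a j) / r))
    (fun a => Complex.I * ((1 / r : ℝ) : ℂ) * W (1/2) 1 S ((δ + ∑ j, Function.update x i a j) / r))
    (fun a => Complex.I * ((1 / r : ℝ) : ℂ) * (Complex.I * ((1 / r : ℝ) : ℂ) *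
      W (1/2) 2 S ((δ + ∑ j, Function.update x i a j) / r)))
    k
    (fun p a => W_affine _ 0 hS _ _ (hy p) a)
    (fun p a => (W_affine _ 1 hS _ _ (hy p) a).const_mul _)
    (fun a => W_affine _ 0 hS _ _ hz a)
    (fun a => (W_affine _ 1 hS _ _ hz a).const_mul _)]
  simp only [Function.update_eq_self, ← hf, ← hg, ← hh]
  have c1 : ∀ p, ((er i p / r : ℝ) : ℂ) = ee i p / r := fun p => by
    rw [Complex.ofReal_div, er_cast]
  simp only [c1]
  have s1 : ∑ p ∈ PP N, (∏ q ∈ (PP N).erase p, f q) * (Complex.I * (ee i p / r) * g p) =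
      Complex.I / r * ∑ p ∈ PP N, ee i p * (g p * ∏ q ∈ (PP N).erase p, f q) := by
    rw [Finset.mul_sum]
    exact Finset.sum_congr rfl fun p _ => by ring
  have s2 : ∑ p ∈ PP N, ((∑ q ∈ (PP N).erase p, (∏ w ∈ ((PP N).erase p).erase q, f w) *
      (Complex.I * (ee i p / r) * g p - Complex.I * (ee i p / r) * g p + Complex.I * (ee i q / r) * g q)) * (Complex.I * (ee i p / r) * g p)
      + (∏ q ∈ (PP N).erase p, f q) * (Complex.I * (ee i p / r) * (Complex.I * (ee i p / r) * h p))) =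
      Complex.I ^ 2 / r ^ 2 * (∑ p ∈ PP N, ∑ q ∈ (PP N).erase p, ee i p * ee i q *
          (g p * g q * ∏ w ∈ ((PP N).erase p).erase q, f w)
        + ∑ p ∈ PP N, ee i p ^ 2 * (h p * ∏ q ∈ (PP N).erase p, f q)) := by
    rw [← Finset.sum_add_distrib, Finset.mul_sum]
    refine Finset.sum_congr rfl fun p _ => ?_
    rw [mul_add, Finset.mul_sum, Finset.sum_mul]
    congr 1
    · exact Finset.sum_congr rfl fun q _ => by ring
    · ring
  simp only [sub_self, zero_add] at s2
  rw [s1, s2]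
  push_cast
  rw [Complex.I_sq]
  field_simp
  rw [Complex.I_sq]
  ring

theorem stmt_14 (N : ℕ) (hN : 2 ≤ N) (r tstar δ : ℝ) (hr : 0 < r)
    (hδ : ∃ m : ℤ, δ = Real.pi * r * m) (htstar : 0 < tstar)
    (t : ℝ) (ht : 0 ≤ t) (htt : t < tstar) (x : Fin N → ℝ) :
    deriv (fun s : ℝ => hA N r tstar δ (tstar - s) x) t +
      (1 / 2) * ∑ j : Fin N,
        iteratedDeriv 2
          (fun a : ℝ => hA N r tstar δ (tstar - t) (Function.update x j a)) (x j) = 0 := by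

  have hN0 : (0 : ℝ) < N := by exact_mod_cast (by omega : 0 < N)
  have hr' : (r : ℂ) ≠ 0 := by exact_mod_cast hr.ne'
  set κ : ℝ := N / (2 * r ^ 2) with hκ
  have hκ0 : 0 < κ := by positivity
  have hst : 0 < tstar - t := by linarith
  set S : ℝ := κ * (tstar - t) with hSdef
  have hS : 0 < S := by positivity
  set M : ℕ := (N - 1) * (N - 2) / 2 with hM
  set E : ℂ := W (1/6) 0 (3 * S) 0 with hE
  set E2 : ℂ := W (1/6) 2 (3 * S) 0 with hE2
  have hE0 : E ≠ 0 := (eta_W (by positivity : 0 < 3 * S)).2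
  set f : Fin N × Fin N → ℂ := fun p => W (1/2) 0 S ((x p.2 - x p.1) / r) with hf
  set g : Fin N × Fin N → ℂ := fun p => W (1/2) 1 S ((x p.2 - x p.1) / r) with hg
  set h : Fin N × Fin N → ℂ := fun p => W (1/2) 2 S ((x p.2 - x p.1) / r) with hh
  set K := KK N r tstar
  set Y : ℝ := (δ + ∑ j, x j) / r with hY
  have hcomb := comb hN f g h E E2 (fun a b c _ _ => W_triple hS _ _ _ (by simp only; ring))
  -- the time derivative
  have hlin : HasDerivAt (fun s : ℝ => κ * (tstar - s)) (-κ) t := by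
    simpa using ((hasDerivAt_id t).const_sub tstar).const_mul κ
  have hW : ∀ y, HasDerivAt (fun s : ℝ => W (1/2) 0 (κ * (tstar - s)) y) (κ * W (1/2) 2 S y) t := by
    intro y
    have := (W_deriv_s (1/2) 0 hS y).scomp t hlin
    refine this.congr_deriv ?_
    rw [Complex.real_smul]; push_cast; ring
  have hEd : HasDerivAt (fun s : ℝ => W (1/6) 0 (3 * (κ * (tstar - s))) 0) (3 * κ * E2) t := by
    have := (W_deriv_s (1/6) 0 (by positivity : 0 < 3 * S) 0).scomp t (hlin.const_mul 3)
    refine this.congr_deriv ?_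
    rw [Complex.real_smul]; push_cast; ring
  have hEp : HasDerivAt (fun s : ℝ => (W (1/6) 0 (3 * (κ * (tstar - s))) 0) ^ (-(M : ℤ)))
      (-(M : ℂ) * E ^ (-(M : ℤ) - 1) * (3 * κ * E2)) t := by
    have h1 := hasDerivAt_zpow (-(M : ℤ)) E (Or.inl hE0)
    have h2 := h1.comp t hEd
    refine h2.congr_deriv ?_
    push_cast; ring
  have hPd : HasDerivAt (fun s : ℝ => ∏ p ∈ PP N, W (1/2) 0 (κ * (tstar - s)) ((x p.2 - x p.1) / r))
      (∑ p ∈ PP N, (∏ q ∈ (PP N).erase p, f q) * (κ * h p)) t := by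
    simpa only [smul_eq_mul] using HasDerivAt.fun_finsetProd (u := PP N)
      (f := fun p s => W (1/2) 0 (κ * (tstar - s)) ((x p.2 - x p.1) / r))
      (f' := fun p => κ * h p) (x := t) (fun p _ => hW _)
  have htime : deriv (fun s : ℝ => hA N r tstar δ (tstar - s) x) t =
      (K * (-(M : ℂ) * E ^ (-(M : ℤ) - 1) * (3 * κ * E2)) * W (1/2) 0 S Y
        + K * E ^ (-(M : ℤ)) * (κ * W (1/2) 2 S Y)) * ∏ p ∈ PP N, f p
      + K * E ^ (-(M : ℤ)) * W (1/2) 0 S Y *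
        ∑ p ∈ PP N, (∏ q ∈ (PP N).erase p, f q) * (κ * h p) := by
    refine (Filter.EventuallyEq.deriv_eq ?_).trans
      (((hEp.const_mul K).mul (hW Y)).mul hPd).deriv
    filter_upwards [Iio_mem_nhds htt] with s hs
    exact hA_eq N hN tstar δ hr (by simpa using hs) x
  have hspace := fun i : Fin N =>
    (show iteratedDeriv 2 (fun a : ℝ => hA N r tstar δ (tstar - t) (Function.update x i a)) (x i) =
      iteratedDeriv 2 (fun a : ℝ => (K * E ^ (-(M : ℤ))) *
        W (1/2) 0 S ((δ + ∑ j, Function.update x i a j) / r) *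
        ∏ p ∈ PP N, W (1/2) 0 S ((Function.update x i a p.2 - Function.update x i a p.1) / r)) (x i)
      from by
        congr 1; funext a; exact hA_eq N hN tstar δ hr hst _).trans
    (space_part N hr δ hS (K * E ^ (-(M : ℤ))) x i f g h (fun _ => rfl) (fun _ => rfl) (fun _ => rfl))
  rw [htime]
  simp_rw [hspace]
  rw [← Finset.mul_sum, Finset.sum_add_distrib, Finset.sum_add_distrib, ← Finset.mul_sum,
    ← Finset.mul_sum, ← Finset.mul_sum, Finset.sum_add_distrib]
  have z1 : ∑ i, ∑ p ∈ PP N, ee i p * (g p * ∏ q ∈ (PP N).erase p, f q) = 0 := by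
    rw [Finset.sum_comm]
    refine Finset.sum_eq_zero fun p _ => ?_
    rw [← Finset.sum_mul, sum_ee, zero_mul]
  have z2 : ∑ i, ∑ p ∈ PP N, ee i p ^ 2 * (h p * ∏ q ∈ (PP N).erase p, f q) =
      2 * ∑ p ∈ PP N, h p * ∏ q ∈ (PP N).erase p, f q := by
    rw [Finset.sum_comm, Finset.mul_sum]
    refine Finset.sum_congr rfl fun p hp => ?_
    rw [← Finset.sum_mul, sum_ee_sq p hp]
  have z3 : ∑ i, ∑ p ∈ PP N, ∑ q ∈ (PP N).erase p, ee i p * ee i q *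
          (g p * g q * ∏ w ∈ ((PP N).erase p).erase q, f w) =
      ∑ p ∈ PP N, ∑ q ∈ (PP N).erase p, (∑ i, ee i p * ee i q) *
        (g p * g q * ∏ w ∈ ((PP N).erase p).erase q, f w) := by
    rw [Finset.sum_comm]
    refine Finset.sum_congr rfl fun p _ => ?_
    rw [Finset.sum_comm]
    exact Finset.sum_congr rfl fun q _ => by rw [Finset.sum_mul]
  have z4 : ∑ p ∈ PP N, (∏ q ∈ (PP N).erase p, f q) * (κ * h p) =
      κ * ∑ p ∈ PP N, h p * ∏ q ∈ (PP N).erase p, f q := by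
    rw [Finset.mul_sum]
    exact Finset.sum_congr rfl fun p _ => by ring
  have hEM : E ^ (-(M : ℤ)) = E * E ^ (-(M : ℤ) - 1) := by
    rw [mul_comm, ← zpow_add_one₀ hE0]; congr 1; ring
  rw [z1, z2, z3, z4]
  simp only [Finset.sum_const, Finset.card_univ, Fintype.card_fin, nsmul_eq_mul]
  have hκc : (κ : ℂ) = N / (2 * r ^ 2) := by rw [hκ]; push_cast; rfl
  rw [← hY]
  rw [hEM, hκc]
  rw [← hM] at hcomb
  generalize ∑ p ∈ PP N, ∑ q ∈ (PP N).erase p, (∑ i, ee i p * ee i q) *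
        (g p * g q * ∏ w ∈ ((PP N).erase p).erase q, f w) = Q at *
  generalize ∑ p ∈ PP N, h p * ∏ q ∈ (PP N).erase p, f q = H at *
  generalize ∏ p ∈ PP N, f p = Pf at *
  generalize E ^ (-(M : ℤ) - 1) = E' at *
  linear_combination (-(K * E' / (2 * r ^ 2)) * W (1/2) 0 S Y) * hcomb
end

section
/- Let N ≥ 2 and let f : ℂ → ℂ be odd, i.e. f(−z) = −f(z) for all z ∈ ℂ. Then for every x = (x_1,…,x_N) ∈ ℂ^N: Σ_{1≤j,k,ℓ≤N, j,k,ℓ pairwise distinct} f(x_j − x_k)·(x_j − x_ℓ) = ((N−2)/2) · Σ_{1≤j,k≤N, j≠k} f(x_j − x_k)·(x_j − x_k). -/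
theorem stmt_15 (N : ℕ) (hN : 2 ≤ N) (f : ℂ → ℂ)
    (hodd : ∀ z : ℂ, f (-z) = -f z) (x : Fin N → ℂ) :
    (∑ j : Fin N, ∑ k : Fin N, ∑ ℓ : Fin N,
        if j ≠ k ∧ k ≠ ℓ ∧ j ≠ ℓ then f (x j - x k) * (x j - x ℓ) else 0) =
      (((N : ℂ) - 2) / 2) * ∑ j : Fin N, ∑ k : Fin N,
        if j ≠ k then f (x j - x k) * (x j - x k) else 0 := by
  have h0 : f 0 = 0 := by
    have h := hodd 0
    rw [neg_zero] at h
    exact self_eq_neg.mp h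
  have hS : ∀ j k : Fin N, (if j ≠ k then f (x j - x k) * (x j - x k) else 0)
      = f (x j - x k) * (x j - x k) := by
    intro j k
    by_cases h : j = k <;> simp [h]
  have hT : ∀ j k l : Fin N,
      (if j ≠ k ∧ k ≠ l ∧ j ≠ l then f (x j - x k) * (x j - x l) else 0)
      = f (x j - x k) * (x j - x l) - if k = l then f (x j - x k) * (x j - x l) else 0 := by
    intro j k l
    by_cases h1 : j = k
    · simp [h1, h0]
    · by_cases h2 : k = l
      · simp [h2]
      · by_cases h3 : j = l <;> simp [h1, h2, h3]
  simp only [hS, hT, Finset.sum_sub_distrib, Finset.sum_ite_eq, Finset.mem_univ, if_true]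
  have hA : (∑ j : Fin N, ∑ k : Fin N, ∑ l : Fin N, f (x j - x k) * (x j - x l))
      + (∑ j : Fin N, ∑ k : Fin N, ∑ l : Fin N, f (x j - x k) * (x j - x l))
      = N * ∑ j : Fin N, ∑ k : Fin N, f (x j - x k) * (x j - x k) := by
    conv_lhs => 
      arg 2
      rw [Finset.sum_comm]
    simp only [← Finset.sum_add_distrib, Finset.mul_sum]
    refine Finset.sum_congr rfl fun j _ => Finset.sum_congr rfl fun k _ => ?_
    have h : ∀ l : Fin N, f (x j - x k) * (x j - x l) + f (x k - x j) * (x k - x l)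
        = f (x j - x k) * (x j - x k) := by
      intro l
      rw [← neg_sub (x j) (x k), hodd]
      ring
    simp [h]
  linear_combination hA / 2
end

section
/- Let N ≥ 1, a > 0, t ≥ 0, and x ∈ ℝ with x ≠ 0. Then lim_{α→∞} A_N^α(aα − t, x) = (1/(2Na))·coth(x/(2Na)), where the limit is over α → ∞ (so that eventually aα − t > 0 and x/α ∉ ℤ∖{0}). -/
/-- The drift function
`A_N^α(s,x) = (π/α)·cot(πx/α)
  + (4π/α)·∑_{n≥1} [q_n/(1-q_n)]·sin(2πnx/α)` with `q_n = e^{-4π²nNs/α²}`. -/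
noncomputable def Adrift (N : ℕ) (α s x : ℝ) : ℝ :=
  (Real.pi / α) * Real.cot (Real.pi * x / α) +
    (4 * Real.pi / α) * ∑' n : ℕ,
      (Real.exp (-(4 * Real.pi ^ 2 * ((n : ℝ) + 1) * N * s) / α ^ 2) /
          (1 - Real.exp (-(4 * Real.pi ^ 2 * ((n : ℝ) + 1) * N * s) / α ^ 2))) *
        Real.sin (2 * Real.pi * ((n : ℝ) + 1) * x / α)

open Filter Topology

lemma aux_scale (f : ℝ → ℝ) (d : ℝ) (hf : HasDerivAt f d 0) (h0 : f 0 = 0) (g : ℝ → ℝ) (L : ℝ)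
    (hg : Tendsto (fun α => α * g α) atTop (𝓝 L)) :
    Tendsto (fun α => α * f (g α)) atTop (𝓝 (L * d)) := by
  have hg0 : Tendsto g atTop (𝓝 0) := by
    have h := tendsto_inv_atTop_zero.mul hg
    rw [zero_mul] at h
    refine h.congr' ?_
    filter_upwards [eventually_gt_atTop 0] with α hα
    field_simp
  have hc : ContinuousAt (dslope f 0) 0 := continuousAt_dslope_same.2 hf.differentiableAt
  have h1 : Tendsto (fun α => dslope f 0 (g α)) atTop (𝓝 d) := by
    have := hc.tendsto.comp hg0
    rwa [dslope_same, hf.deriv] at this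
  refine (hg.mul h1).congr fun α => ?_
  have := sub_smul_dslope f 0 (g α)
  simp only [sub_zero, h0, smul_eq_mul] at this
  rw [mul_assoc, this]

lemma aux_geom (c θ : ℝ) (hc : 0 < c) :
    HasSum (fun n : ℕ => Real.exp (-(((n : ℝ) + 1) * c)) * Real.sin (((n : ℝ) + 1) * θ))
      (Real.sin θ / (4 * (Real.sinh (c / 2) ^ 2 + Real.sin (θ / 2) ^ 2))) := by
  set w : ℂ := Complex.exp ((-c : ℝ) + θ * Complex.I) with hw
  have hn : ‖w‖ < 1 := by
    rw [hw, Complex.norm_exp]; simp [hc]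
  have h := Complex.hasSum_im ((hasSum_geometric_of_norm_lt_one hn).mul_left w)
  have hre : w.re = Real.exp (-c) * Real.cos θ := by
    rw [hw, Complex.exp_re]; simp
  have him : w.im = Real.exp (-c) * Real.sin θ := by
    rw [hw, Complex.exp_im]; simp
  convert h using 1
  · ext n
    rw [← pow_succ', hw, ← Complex.exp_nat_mul, Complex.exp_im]
    simp
  · rw [Complex.mul_im, Complex.inv_re, Complex.inv_im, Complex.normSq_apply]
    simp only [Complex.sub_re, Complex.sub_im, Complex.one_re, Complex.one_im, hre, him]
    have hs : 0 < Real.sinh (c / 2) := Real.sinh_pos_iff.2 (by linarith)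
    have h1 : 4 * (Real.sinh (c / 2) ^ 2 + Real.sin (θ / 2) ^ 2)
        = Real.exp c + Real.exp (-c) - 2 * Real.cos θ := by
      have e1 := Real.cosh_two_mul (c / 2)
      have e2 := Real.cos_two_mul (θ / 2)
      have e3 := Real.cosh_sq (c / 2)
      have e4 := Real.sin_sq_add_cos_sq (θ / 2)
      have e5 := Real.cosh_eq c
      rw [show 2 * (c / 2) = c by ring] at e1
      rw [show 2 * (θ / 2) = θ by ring] at e2
      linarith
    have hp : 0 < Real.exp c + Real.exp (-c) - 2 * Real.cos θ := by rw [← h1]; positivity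
    have hE : Real.exp c * Real.exp (-c) = 1 := by rw [← Real.exp_add]; simp
    have hq : (1 - Real.exp (-c) * Real.cos θ) * (1 - Real.exp (-c) * Real.cos θ) +
        (0 - Real.exp (-c) * Real.sin θ) * (0 - Real.exp (-c) * Real.sin θ)
        = Real.exp (-c) * (Real.exp c + Real.exp (-c) - 2 * Real.cos θ) := by
      linear_combination -hE + Real.exp (-c) ^ 2 * Real.sin_sq_add_cos_sq θ
    rw [h1, hq]
    have := (Real.exp_pos (-c)).ne'
    have := hp.ne'
    field_simp
    ring

lemma aux_swap (c θ : ℝ) (hc : 0 < c) :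
    ∑' n : ℕ, (Real.exp (-(((n : ℝ) + 1) * c)) / (1 - Real.exp (-(((n : ℝ) + 1) * c))))
        * Real.sin (((n : ℝ) + 1) * θ)
    = ∑' k : ℕ, Real.sin θ /
        (4 * (Real.sinh (((k : ℝ) + 1) * c / 2) ^ 2 + Real.sin (θ / 2) ^ 2)) := by
  let F : ℕ → ℕ → ℝ := fun n k =>
    Real.exp (-(((n : ℝ) + 1) * (((k : ℝ) + 1) * c))) * Real.sin (((n : ℝ) + 1) * θ)
  have hF : Summable (Function.uncurry F) := by
    have hg : Summable (fun n : ℕ => Real.exp (-c) ^ n) :=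
      summable_geometric_of_lt_one (Real.exp_pos _).le (by simpa using hc)
    have hp := hg.mul_of_nonneg hg (fun n => by positivity) (fun n => by positivity)
    refine Summable.of_norm_bounded hp ?_
    rintro ⟨n, k⟩
    simp only [Function.uncurry, F, norm_mul, Real.norm_eq_abs, Real.abs_exp]
    calc _ ≤ Real.exp (-(((n : ℝ) + 1) * (((k : ℝ) + 1) * c))) * 1 := by
            gcongr; exact Real.abs_sin_le_one _
      _ ≤ _ := by
            rw [mul_one, ← Real.exp_nat_mul, ← Real.exp_nat_mul, ← Real.exp_add]
            apply Real.exp_le_exp.2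
            have : 0 ≤ (n * k + 1 : ℝ) * c := by positivity
            nlinarith
  calc _ = ∑' n, ∑' k, F n k := by
        refine tsum_congr fun n => ?_
        have hc' : 0 < ((n : ℝ) + 1) * c := by positivity
        have h1 := (hasSum_geometric_of_lt_one (Real.exp_pos (-(((n : ℝ) + 1) * c))).le
          (by simpa using hc')).mul_left (Real.exp (-(((n : ℝ) + 1) * c)) * Real.sin (((n : ℝ) + 1) * θ))
        have h2 := h1.tsum_eq
        rw [show (Real.exp (-(((n : ℝ) + 1) * c)) / (1 - Real.exp (-(((n : ℝ) + 1) * c))))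
          * Real.sin (((n : ℝ) + 1) * θ) = Real.exp (-(((n : ℝ) + 1) * c)) * Real.sin (((n : ℝ) + 1) * θ) * (1 - Real.exp (-(((n : ℝ) + 1) * c)))⁻¹ by rw [div_eq_mul_inv]; ring, ← h2]
        refine tsum_congr fun k => ?_
        simp only [F]
        rw [mul_right_comm, ← Real.exp_nat_mul, ← Real.exp_add]
        congr 2; ring
    _ = ∑' k, ∑' n, F n k := hF.tsum_comm.symm
    _ = _ := by
        refine tsum_congr fun k => ?_
        exact (aux_geom (((k : ℝ) + 1) * c) θ (by positivity)).tsum_eq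

lemma aux_coth (y : ℝ) (hy : y ≠ 0) :
    1 / y + ∑' k : ℕ, 2 * y / (((k : ℝ) + 1) ^ 2 + y ^ 2)
      = Real.pi * (Real.cosh (Real.pi * y) / Real.sinh (Real.pi * y)) := by
  have hz : (y * Complex.I : ℂ) ∈ Complex.integerComplement := by
    rw [Complex.mem_integerComplement_iff]
    rintro ⟨n, hn⟩
    have := congrArg Complex.im hn
    simp at this
    exact hy this.symm
  have h := cot_series_rep hz
  rw [tsum_pnat_eq_tsum_succ (f := fun n : ℕ => (1 / ((y * Complex.I : ℂ) - n) + 1 / ((y * Complex.I : ℂ) + n)))] at h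
  have hs : Real.sinh (Real.pi * y) ≠ 0 := by
    rw [Ne, Real.sinh_eq_zero]; positivity
  have hyC : (y : ℂ) ≠ 0 := by exact_mod_cast hy
  have hsC : Complex.sinh (Real.pi * y) ≠ 0 := by exact_mod_cast hs
  have e1 : ∀ k : ℕ, (1 / ((y * Complex.I : ℂ) - ((k + 1 : ℕ) : ℂ)) + 1 / ((y * Complex.I : ℂ) + ((k + 1 : ℕ) : ℂ)))
      = -Complex.I * ((2 * y / (((k : ℝ) + 1) ^ 2 + y ^ 2) : ℝ) : ℂ) := by
    intro k
    have hk : (((k : ℂ) + 1) ^ 2 + y ^ 2) ≠ 0 := by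
      have : (((k : ℝ) + 1) ^ 2 + y ^ 2) ≠ 0 := by positivity
      exact_mod_cast this
    have hI := Complex.I_sq
    have a1 : (y * Complex.I : ℂ) - ((k : ℂ) + 1) ≠ 0 := by
      intro h0; apply hk
      linear_combination (-(y * Complex.I : ℂ) - ((k : ℂ) + 1)) * h0 + (y:ℂ)^2 * hI
    have a2 : (y * Complex.I : ℂ) + ((k : ℂ) + 1) ≠ 0 := by
      intro h0; apply hk
      linear_combination (-(y * Complex.I : ℂ) + ((k : ℂ) + 1)) * h0 + (y:ℂ)^2 * hI
    push_cast
    rw [div_add_div _ _ a1 a2, ← mul_div_assoc, div_eq_div_iff (mul_ne_zero a1 a2) hk]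
    linear_combination (2 * y ^ 3 * Complex.I : ℂ) * hI
  rw [tsum_congr e1, tsum_mul_left, ← Complex.ofReal_tsum] at h
  have e2 : Complex.cot (Real.pi * (y * Complex.I)) = -Complex.I * (Complex.cosh (Real.pi * y) / Complex.sinh (Real.pi * y)) := by
    rw [Complex.cot, ← mul_assoc, Complex.cos_mul_I, Complex.sin_mul_I]
    field_simp
    simp
  rw [e2] at h
  have e3 : 1 / (y * Complex.I : ℂ) = -Complex.I * (1 / y) := by
    field_simp
    simp
  rw [e3] at h
  have h4 := mul_left_cancel₀ (neg_ne_zero.2 Complex.I_ne_zero) (a := -Complex.I)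
    (b := Real.pi * (Complex.cosh (Real.pi * y) / Complex.sinh (Real.pi * y)) - 1 / y)
    (c := ((∑' k : ℕ, 2 * y / (((k : ℝ) + 1) ^ 2 + y ^ 2) : ℝ) : ℂ))
    (by linear_combination h)
  have h5 : Real.pi * (Real.cosh (Real.pi * y) / Real.sinh (Real.pi * y)) - 1 / y = ∑' k : ℕ, 2 * y / (((k : ℝ) + 1) ^ 2 + y ^ 2) := by
    apply Complex.ofReal_injective
    rw [← h4]; push_cast; rfl
  rw [← h5]; ring

theorem stmt_17 (N : ℕ) (hN : 1 ≤ N) (a : ℝ) (ha : 0 < a) (t : ℝ) (ht : 0 ≤ t)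
    (x : ℝ) (hx : x ≠ 0) :
    Filter.Tendsto (fun α : ℝ => Adrift N α (a * α - t) x) Filter.atTop
      (nhds ((1 / (2 * N * a)) *
        (Real.cosh (x / (2 * N * a)) / Real.sinh (x / (2 * N * a))))) := by
  have hN0 : (0 : ℝ) < N := by exact_mod_cast hN
  have hpi := Real.pi_pos
  set c : ℝ → ℝ := fun α => 4 * Real.pi ^ 2 * N * (a * α - t) / α ^ 2 with hcdef
  have hc : Tendsto (fun α => α * c α) atTop (𝓝 (4 * Real.pi ^ 2 * N * a)) := by
    have h : Tendsto (fun α : ℝ => 4 * Real.pi ^ 2 * N * (a - t * α⁻¹)) atTop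
        (𝓝 (4 * Real.pi ^ 2 * N * (a - t * 0))) :=
      (tendsto_const_nhds.sub (tendsto_inv_atTop_zero.const_mul t)).const_mul _
    rw [mul_zero, sub_zero] at h
    refine h.congr' ?_
    filter_upwards [eventually_gt_atTop 0] with α hα
    simp only [hcdef]
    field_simp
  have hlin : ∀ K : ℝ, Tendsto (fun α : ℝ => α * (K / α)) atTop (𝓝 K) := by
    intro K
    refine (tendsto_const_nhds (x := K)).congr' ?_
    filter_upwards [eventually_gt_atTop 0] with α hα
    field_simp
  have hsin : ∀ K : ℝ, Tendsto (fun α : ℝ => α * Real.sin (K / α)) atTop (𝓝 K) := by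
    intro K
    simpa using aux_scale Real.sin 1 (by simpa using Real.hasDerivAt_sin 0) (by simp) _ _ (hlin K)
  have hsinh : ∀ k : ℕ, Tendsto (fun α : ℝ => α * Real.sinh (((k : ℝ) + 1) * c α / 2)) atTop
      (𝓝 (((k : ℝ) + 1) * (2 * Real.pi ^ 2 * N * a))) := by
    intro k
    have h := aux_scale Real.sinh 1 (by simpa using Real.hasDerivAt_sinh 0) (by simp)
      (fun α => ((k : ℝ) + 1) * c α / 2) (((k : ℝ) + 1) * (2 * Real.pi ^ 2 * N * a)) (by
        convert hc.mul_const (((k : ℝ) + 1) / 2) using 1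
        · ext α; ring
        · congr 1; ring)
    simpa using h
  have hcot : Tendsto (fun α : ℝ => (Real.pi / α) * Real.cot (Real.pi * x / α)) atTop (𝓝 (1 / x)) := by
    have hcos : Tendsto (fun α : ℝ => Real.cos (Real.pi * x / α)) atTop (𝓝 1) := by
      have : Tendsto (fun α : ℝ => Real.pi * x / α) atTop (𝓝 0) := tendsto_const_nhds.div_atTop tendsto_id
      have h0 := (Real.continuous_cos.tendsto 0).comp this
      rw [Real.cos_zero] at h0
      exact h0
    have h := (hcos.const_mul Real.pi).div (hsin (Real.pi * x)) (by positivity)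
    convert h using 1
    · ext α
      simp only [Pi.div_apply]
      rw [Real.cot_eq_cos_div_sin, div_mul_div_comm]
    · congr 1; field_simp
  have hsum : Tendsto (fun α : ℝ => ∑' k : ℕ, Real.pi * (α * Real.sin (2 * Real.pi * x / α)) /
      ((α * Real.sinh (((k : ℝ) + 1) * c α / 2)) ^ 2 + (α * Real.sin (Real.pi * x / α)) ^ 2)) atTop
      (𝓝 (∑' k : ℕ, Real.pi * (2 * Real.pi * x) /
        ((((k : ℝ) + 1) * (2 * Real.pi ^ 2 * N * a)) ^ 2 + (Real.pi * x) ^ 2))) := by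
    refine tendsto_tsum_of_dominated_convergence
      (bound := fun k : ℕ => Real.pi * |2 * Real.pi * x| / (Real.pi ^ 2 * N * a) ^ 2 *
        (1 / ((k + 1 : ℕ) : ℝ) ^ 2)) ?_ ?_ ?_
    · exact ((summable_nat_add_iff 1).2 (Real.summable_one_div_nat_pow.2 one_lt_two)).mul_left _
    · intro k
      refine ((hsin _).const_mul _).div (((hsinh k).pow 2).add ((hsin _).pow 2)) (by positivity)
    · have hev : ∀ᶠ α in atTop, 2 * Real.pi ^ 2 * N * a < α * c α :=
        hc.eventually_const_lt (by nlinarith [show 0 < Real.pi ^ 2 * N * a by positivity])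
      filter_upwards [eventually_gt_atTop 0, hev] with α hα hcα k
      have hcp : 0 < c α := by
        have : 0 < α * c α := lt_trans (by positivity) hcα
        exact (pos_iff_pos_of_mul_pos this).1 hα
      have h1 : |α * Real.sin (2 * Real.pi * x / α)| ≤ |2 * Real.pi * x| := by
        rw [abs_mul, abs_of_pos hα]
        calc _ ≤ α * |2 * Real.pi * x / α| := mul_le_mul_of_nonneg_left Real.abs_sin_le_abs hα.le
          _ = _ := by rw [abs_div, abs_of_pos hα]; field_simp
      have h2 : (Real.pi ^ 2 * N * a) * (k + 1) ≤ α * Real.sinh (((k : ℝ) + 1) * c α / 2) := by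
        have h3 : ((k : ℝ) + 1) * c α / 2 ≤ Real.sinh (((k : ℝ) + 1) * c α / 2) :=
          Real.self_le_sinh_iff.2 (by positivity)
        calc (Real.pi ^ 2 * N * a) * ((k : ℝ) + 1) ≤ (α * c α / 2) * ((k : ℝ) + 1) := by
              gcongr; linarith
          _ = α * (((k : ℝ) + 1) * c α / 2) := by ring
          _ ≤ _ := by gcongr
      have hD : 0 ≤ (α * Real.sinh (((k : ℝ) + 1) * c α / 2)) ^ 2 +
          (α * Real.sin (Real.pi * x / α)) ^ 2 := by positivity
      rw [Real.norm_eq_abs, abs_div, abs_mul, abs_of_nonneg hD, abs_of_pos hpi]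
      calc _ ≤ Real.pi * |2 * Real.pi * x| / ((Real.pi ^ 2 * N * a) * (k + 1)) ^ 2 := by
            refine div_le_div₀ (by positivity) (mul_le_mul_of_nonneg_left h1 hpi.le)
              (by positivity) ?_
            have : ((Real.pi ^ 2 * N * a) * ((k:ℝ) + 1)) ^ 2 ≤ (α * Real.sinh (((k : ℝ) + 1) * c α / 2)) ^ 2 := by
              gcongr
            nlinarith [sq_nonneg (α * Real.sin (Real.pi * x / α))]
        _ = _ := by push_cast; field_simp
  have htot := hcot.add hsum
  have hlim : 1 / x + ∑' k : ℕ, Real.pi * (2 * Real.pi * x) /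
        ((((k : ℝ) + 1) * (2 * Real.pi ^ 2 * N * a)) ^ 2 + (Real.pi * x) ^ 2)
      = (1 / (2 * N * a)) * (Real.cosh (x / (2 * N * a)) / Real.sinh (x / (2 * N * a))) := by
    have h := aux_coth (x / (2 * Real.pi * N * a)) (by positivity)
    have e : Real.pi * (x / (2 * Real.pi * N * a)) = x / (2 * N * a) := by field_simp
    rw [e] at h
    have h' := congrArg (fun z => 1 / (2 * Real.pi * N * a) * z) h
    simp only [mul_add, ← tsum_mul_left] at h'
    convert h' using 1
    · congr 1
      · field_simp
      · refine tsum_congr fun k => ?_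
        have : 0 < (((k : ℝ) + 1) * (2 * Real.pi ^ 2 * N * a)) ^ 2 + (Real.pi * x) ^ 2 := by positivity
        have : 0 < (((k : ℝ) + 1)) ^ 2 + (x / (2 * Real.pi * N * a)) ^ 2 := by positivity
        rw [← mul_div_assoc, div_eq_div_iff (by positivity) (by positivity)]
        field_simp
        try ring
    · field_simp
  rw [hlim] at htot
  refine htot.congr' ?_
  have hs : ∀ᶠ α : ℝ in atTop, t / a < α := eventually_gt_atTop _
  filter_upwards [eventually_gt_atTop 0, hs] with α hα hα2
  have hsp : 0 < a * α - t := by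
    rw [div_lt_iff₀ ha] at hα2; linarith
  have hcp : 0 < c α := by simp only [hcdef]; positivity
  unfold Adrift
  congr 1
  have h := aux_swap (c α) (2 * Real.pi * x / α) hcp
  have e1 : ∀ n : ℕ, -(4 * Real.pi ^ 2 * ((n : ℝ) + 1) * N * (a * α - t)) / α ^ 2 = -(((n : ℝ) + 1) * c α) := by
    intro n; simp only [hcdef]; ring
  have e2 : ∀ n : ℕ, 2 * Real.pi * ((n : ℝ) + 1) * x / α = ((n : ℝ) + 1) * (2 * Real.pi * x / α) := by
    intro n; ring
  simp only [e1, e2]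
  rw [h, ← tsum_mul_left]
  refine tsum_congr fun k => ?_
  have hsk : 0 < Real.sinh (((k : ℝ) + 1) * c α / 2) := Real.sinh_pos_iff.2 (by positivity)
  rw [show 2 * Real.pi * x / α / 2 = Real.pi * x / α by ring]
  have hd : 0 < Real.sinh (((k : ℝ) + 1) * c α / 2) ^ 2 + Real.sin (Real.pi * x / α) ^ 2 := by positivity
  rw [mul_pow, mul_pow, ← mul_add]
  field_simp
end

section
/- Let N ≥ 2, a > 0, δ ∈ ℝ, and let u_1,…,u_N ∈ ℝ be pairwise distinct with ū_δ := δ + Σ_{j=1}^N u_j ≠ 0. Fix 1 ≤ k ≤ N and z ∈ ℂ. For r > 0 set t* = 2πar. Then lim_{r→∞} Φ^{A,r,2πar}_{u,δ,k}(z) = [sinh((ū_δ + z − u_k)/(2Na)) / sinh(ū_δ/(2Na))] · ∏_{1≤ℓ≤N, ℓ≠k} sinh((z − u_ℓ)/(2Na)) / sinh((u_k − u_ℓ)/(2Na)). -/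
/-- The entire function `Φ^{A,r,t*}_{u,δ,k}(z)` built from Jacobi theta functions with
nome parameter `τ = i N t* / (2π r²)`. -/
noncomputable def PhiA (N : ℕ) (r tstar : ℝ) (u : Fin N → ℝ) (δ : ℝ) (k : Fin N)
    (z : ℂ) : ℂ :=
  theta1 ((((δ + ∑ i, u i : ℝ) : ℂ) + z - ((u k : ℝ) : ℂ)) / (2 * Real.pi * r))
      (Complex.I * N * tstar / (2 * Real.pi * r ^ 2)) /
    theta1 (((δ + ∑ i, u i : ℝ) : ℂ) / (2 * Real.pi * r))
      (Complex.I * N * tstar / (2 * Real.pi * r ^ 2)) *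
  ∏ ℓ ∈ Finset.univ.erase k,
    theta1 ((z - ((u ℓ : ℝ) : ℂ)) / (2 * Real.pi * r))
        (Complex.I * N * tstar / (2 * Real.pi * r ^ 2)) /
      theta1 ((((u k - u ℓ) : ℝ) : ℂ) / (2 * Real.pi * r))
        (Complex.I * N * tstar / (2 * Real.pi * r ^ 2))

open Filter Topology

lemma aux_theta1_eq (v τ : ℂ) : theta1 v τ =
    Complex.I * (Complex.exp (Real.pi * Complex.I * τ / 4 - Real.pi * Complex.I * v) *
      jacobiTheta₂ (v - τ / 2 + 1 / 2) τ) := by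
  unfold theta1 jacobiTheta₂
  congr 1
  refine Eq.trans (tsum_congr fun n => ?_) tsum_mul_left
  have h1 : (-1 : ℂ) ^ n = Complex.exp (Real.pi * Complex.I * n) := by
    rw [← Complex.exp_pi_mul_I, ← Complex.exp_int_mul]
    ring_nf
  rw [h1, jacobiTheta₂_term, ← Complex.exp_add, ← Complex.exp_add, ← Complex.exp_add]
  congr 1
  ring

lemma aux_norm_term (ζ : ℂ) (y : ℝ) (n : ℤ) :
    ‖jacobiTheta₂_term n (ζ - 1 / 2 - Complex.I * y / 2) (Complex.I * y)‖ =
      Real.exp (-2 * Real.pi * n * ζ.im) * Real.exp (-(Real.pi * ((n : ℝ) ^ 2 - n) * y)) := by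
  rw [norm_jacobiTheta₂_term, ← Real.exp_add]
  congr 1
  simp
  ring

lemma aux_int_sq (n : ℤ) : (0 : ℝ) ≤ (n : ℝ) ^ 2 - n := by
  have : (0 : ℤ) ≤ n ^ 2 - n := by
    rcases le_or_gt n 0 with h | h <;> nlinarith
  exact_mod_cast this

lemma aux_tendsto_J (ζ : ℂ) :
    Tendsto (fun y : ℝ => jacobiTheta₂ (ζ - 1 / 2 - Complex.I * y / 2) (Complex.I * y)) atTop
      (𝓝 (1 - Complex.exp (2 * Real.pi * Complex.I * ζ))) := by
  have hlim : ∑' n : ℤ, (if n = 0 then (1 : ℂ) else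
      if n = 1 then - Complex.exp (2 * Real.pi * Complex.I * ζ) else 0) =
      1 - Complex.exp (2 * Real.pi * Complex.I * ζ) := by
    rw [tsum_eq_sum (s := {0, 1})]
    · simp [sub_eq_add_neg]
    · intro b hb
      simp at hb
      simp [hb.1, hb.2]
  rw [← hlim]
  unfold jacobiTheta₂
  refine tendsto_tsum_of_dominated_convergence
    (bound := fun n : ℤ => ‖jacobiTheta₂_term n (ζ - 1 / 2 - Complex.I * (1 : ℝ) / 2)
      (Complex.I * (1 : ℝ))‖) ?_ ?_ ?_
  · apply Summable.norm
    rw [summable_jacobiTheta₂_term_iff]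
    simp
  · intro n
    by_cases h0 : n = 0
    · subst h0
      simp [jacobiTheta₂_term]
    by_cases h1 : n = 1
    · subst h1
      simp only [h0, if_true, if_false]
      refine tendsto_const_nhds.congr fun y => ?_
      rw [jacobiTheta₂_term]
      have : (2 * Real.pi * Complex.I * ((1 : ℤ) : ℂ) * (ζ - 1 / 2 - Complex.I * y / 2) +
          Real.pi * Complex.I * ((1 : ℤ) : ℂ) ^ 2 * (Complex.I * y)) =
          2 * Real.pi * Complex.I * ζ - Real.pi * Complex.I := by
        push_cast
        ring
      rw [this, Complex.exp_sub, Complex.exp_pi_mul_I]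
      ring
    · simp only [h0, h1, if_false]
      rw [tendsto_zero_iff_norm_tendsto_zero]
      simp_rw [aux_norm_term]
      have hpos : 0 < Real.pi * ((n : ℝ) ^ 2 - n) := by
        have : (0 : ℤ) < n ^ 2 - n := by
          rcases lt_or_gt_of_ne h0 with h | h
          · nlinarith
          · have : 2 ≤ n := by omega
            nlinarith
        have : (0 : ℝ) < (n : ℝ) ^ 2 - n := by exact_mod_cast this
        positivity
      have := (Real.tendsto_exp_neg_atTop_nhds_zero.comp
        (tendsto_id.const_mul_atTop hpos)).const_mul (Real.exp (-2 * Real.pi * n * ζ.im))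
      simpa using this
  · filter_upwards [eventually_ge_atTop (1 : ℝ)] with y hy n
    rw [aux_norm_term, aux_norm_term]
    have := aux_int_sq n
    have := Real.pi_pos
    gcongr

noncomputable def auxC (τ : ℂ) : ℂ :=
  Complex.I * Complex.exp (Real.pi * Complex.I * τ / 4) * (1 / (-Complex.I * τ) ^ (1 / 2 : ℂ)) *
    Complex.exp (-(Real.pi * Complex.I * (τ / 4 + 1 / (4 * τ) - 1 / 2))) * (-2)

lemma auxC_ne (τ : ℂ) (h : τ ≠ 0) : auxC τ ≠ 0 := by
  unfold auxC
  have : (-Complex.I * τ) ^ (1 / 2 : ℂ) ≠ 0 := by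
    rw [Complex.cpow_ne_zero_iff]
    left
    simp [h]
  simp only [ne_eq, mul_eq_zero, Complex.exp_ne_zero, Complex.I_ne_zero, div_eq_zero_iff, this]
  norm_num

lemma aux_theta1_modular (v τ : ℂ) (h : τ ≠ 0) : theta1 v τ = auxC τ *
    (-1 / 2 * Complex.exp (-(Real.pi * Complex.I * (v ^ 2 / τ))) *
      Complex.exp (-(Real.pi * Complex.I * (v / τ))) *
      jacobiTheta₂ (v / τ - 1 / 2 - (-1 / τ) / 2) (-1 / τ)) := by
  rw [aux_theta1_eq, jacobiTheta₂_functional_equation]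
  have e1 : (v - τ / 2 + 1 / 2) / τ = v / τ - 1 / 2 - (-1 / τ) / 2 := by
    field_simp
    ring
  rw [e1]
  have e2 : Complex.exp (Real.pi * Complex.I * τ / 4 - Real.pi * Complex.I * v) *
      Complex.exp (-Real.pi * Complex.I * (v - τ / 2 + 1 / 2) ^ 2 / τ) =
      Complex.exp (Real.pi * Complex.I * τ / 4) *
      Complex.exp (-(Real.pi * Complex.I * (τ / 4 + 1 / (4 * τ) - 1 / 2))) *
      Complex.exp (-(Real.pi * Complex.I * (v ^ 2 / τ))) *
      Complex.exp (-(Real.pi * Complex.I * (v / τ))) := by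
    simp only [← Complex.exp_add]
    congr 1
    field_simp
    ring
  unfold auxC
  linear_combination Complex.I * (1 / (-Complex.I * τ) ^ (1 / 2 : ℂ)) *
    jacobiTheta₂ (v / τ - 1 / 2 - (-1 / τ) / 2) (-1 / τ) * e2

noncomputable def auxG (b : ℝ) (w : ℂ) (r : ℝ) : ℂ :=
  -1 / 2 * Complex.exp (-(w ^ 2 / (4 * Real.pi * b)) * ((r⁻¹ : ℝ) : ℂ)) *
    Complex.exp (-(w / (2 * b))) *
    jacobiTheta₂ (w / (2 * Real.pi * Complex.I * b) - 1 / 2 - Complex.I * ((r / b : ℝ) : ℂ) / 2)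
      (Complex.I * ((r / b : ℝ) : ℂ))

lemma aux_theta1_G (b : ℝ) (hb : 0 < b) (w : ℂ) (r : ℝ) (hr : 0 < r) :
    theta1 (w / (2 * Real.pi * r)) (Complex.I * b / r) =
      auxC (Complex.I * b / r) * auxG b w r := by
  have hb' : (b : ℂ) ≠ 0 := by exact_mod_cast hb.ne'
  have hr' : (r : ℂ) ≠ 0 := by exact_mod_cast hr.ne'
  have hpi : (Real.pi : ℂ) ≠ 0 := by exact_mod_cast Real.pi_ne_zero
  have hI := Complex.I_ne_zero
  rw [aux_theta1_modular _ _ (by simp [hb', hr'])]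
  have e0 : (-1 : ℂ) / (Complex.I * b / r) = Complex.I * ((r / b : ℝ) : ℂ) := by
    push_cast
    field_simp
    simp
  have e1 : w / (2 * Real.pi * r) / (Complex.I * b / r) = w / (2 * Real.pi * Complex.I * b) := by
    field_simp
  have e2 : -(Real.pi * Complex.I * ((w / (2 * Real.pi * r)) ^ 2 / (Complex.I * b / r))) =
      -(w ^ 2 / (4 * Real.pi * b)) * ((r⁻¹ : ℝ) : ℂ) := by
    push_cast
    field_simp
    ring
  have e3 : -(Real.pi * Complex.I * (w / (2 * Real.pi * Complex.I * b))) = -(w / (2 * b)) := by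
    field_simp
  rw [e0, e1, e2, e3, auxG]

lemma aux_tendsto_G (b : ℝ) (hb : 0 < b) (w : ℂ) :
    Tendsto (auxG b w) atTop (𝓝 (Complex.sinh (w / (2 * b)))) := by
  have hb' : (b : ℂ) ≠ 0 := by exact_mod_cast hb.ne'
  have hpi : (Real.pi : ℂ) ≠ 0 := by exact_mod_cast Real.pi_ne_zero
  have hI := Complex.I_ne_zero
  have hJ := (aux_tendsto_J (w / (2 * Real.pi * Complex.I * b))).comp
    (tendsto_id.atTop_div_const hb)
  have hE : Tendsto (fun r : ℝ => Complex.exp (-(w ^ 2 / (4 * Real.pi * b)) * ((r⁻¹ : ℝ) : ℂ)))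
      atTop (𝓝 1) := by
    have h0 : Tendsto (fun r : ℝ => ((r⁻¹ : ℝ) : ℂ)) atTop (𝓝 ((0 : ℝ) : ℂ)) :=
      (Complex.continuous_ofReal.tendsto 0).comp tendsto_inv_atTop_zero
    have := (Complex.continuous_exp.tendsto _).comp (h0.const_mul (-(w ^ 2 / (4 * Real.pi * b))))
    simpa [Function.comp_def] using this
  have := ((hE.const_mul (-1 / 2)).mul_const (Complex.exp (-(w / (2 * b))))).mul hJ
  have e : Complex.sinh (w / (2 * b)) = -1 / 2 * 1 * Complex.exp (-(w / (2 * b))) *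
      (1 - Complex.exp (2 * Real.pi * Complex.I * (w / (2 * Real.pi * Complex.I * b)))) := by
    have : 2 * Real.pi * Complex.I * (w / (2 * Real.pi * Complex.I * b)) =
        w / (2 * b) + w / (2 * b) := by
      field_simp
      ring
    rw [this, Complex.exp_add, Complex.sinh, Complex.exp_neg]
    have := Complex.exp_ne_zero (w / (2 * b))
    field_simp
    ring
  rw [e]
  exact this

lemma aux_ratio (b : ℝ) (hb : 0 < b) (w w' : ℂ) (hw : Complex.sinh (w' / (2 * b)) ≠ 0) :
    Tendsto (fun r : ℝ => theta1 (w / (2 * Real.pi * r)) (Complex.I * b / r) /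
      theta1 (w' / (2 * Real.pi * r)) (Complex.I * b / r)) atTop
      (𝓝 (Complex.sinh (w / (2 * b)) / Complex.sinh (w' / (2 * b)))) := by
  refine ((aux_tendsto_G b hb w).div (aux_tendsto_G b hb w') hw).congr' ?_
  filter_upwards [eventually_gt_atTop 0] with r hr
  rw [aux_theta1_G b hb w r hr, aux_theta1_G b hb w' r hr]
  have hb' : (b : ℂ) ≠ 0 := by exact_mod_cast hb.ne'
  have hr' : (r : ℂ) ≠ 0 := by exact_mod_cast hr.ne'
  rw [mul_div_mul_left _ _ (auxC_ne _ (by simp [hb', hr']))]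
  rfl

lemma aux_sinh_ne (b : ℝ) (hb : 0 < b) (x : ℝ) (hx : x ≠ 0) :
    Complex.sinh ((x : ℂ) / (2 * b)) ≠ 0 := by
  have : Complex.sinh ((x : ℂ) / (2 * b)) = ((Real.sinh (x / (2 * b)) : ℝ) : ℂ) := by
    push_cast
    rfl
  rw [this, Complex.ofReal_ne_zero, Real.sinh_ne_zero]
  positivity


theorem stmt_18 (N : ℕ) (hN : 2 ≤ N) (a : ℝ) (ha : 0 < a) (δ : ℝ)
    (u : Fin N → ℝ) (hu : Function.Injective u)
    (hubar : δ + ∑ j, u j ≠ 0) (k : Fin N) (z : ℂ) :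
    Filter.Tendsto (fun r : ℝ => PhiA N r (2 * Real.pi * a * r) u δ k z)
      Filter.atTop
      (nhds ((Complex.sinh ((((δ + ∑ j, u j : ℝ) : ℂ) + z - ((u k : ℝ) : ℂ)) /
              (2 * N * a)) /
            Complex.sinh (((δ + ∑ j, u j : ℝ) : ℂ) / (2 * N * a))) *
          ∏ ℓ ∈ Finset.univ.erase k,
            Complex.sinh ((z - ((u ℓ : ℝ) : ℂ)) / (2 * N * a)) /
              Complex.sinh ((((u k - u ℓ) : ℝ) : ℂ) / (2 * N * a)))) := by
  have hN0 : 0 < N := by omega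
  have hb : 0 < (N : ℝ) * a := by positivity
  have e : ∀ x : ℂ, x / (2 * N * a) = x / (2 * ((N * a : ℝ) : ℂ)) := by
    intro x
    push_cast
    ring
  simp only [e]
  have key : Tendsto (fun r : ℝ =>
      theta1 ((((δ + ∑ i, u i : ℝ) : ℂ) + z - ((u k : ℝ) : ℂ)) / (2 * Real.pi * r))
          (Complex.I * ((N * a : ℝ) : ℂ) / r) /
        theta1 (((δ + ∑ i, u i : ℝ) : ℂ) / (2 * Real.pi * r))
          (Complex.I * ((N * a : ℝ) : ℂ) / r) *
      ∏ ℓ ∈ Finset.univ.erase k,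
        (theta1 ((z - ((u ℓ : ℝ) : ℂ)) / (2 * Real.pi * r))
            (Complex.I * ((N * a : ℝ) : ℂ) / r) /
          theta1 ((((u k - u ℓ) : ℝ) : ℂ) / (2 * Real.pi * r))
            (Complex.I * ((N * a : ℝ) : ℂ) / r))) atTop _ :=
    (aux_ratio _ hb _ _ (aux_sinh_ne _ hb _ hubar)).mul
      (tendsto_finsetProd (Finset.univ.erase k) fun ℓ hℓ =>
        aux_ratio _ hb (z - ((u ℓ : ℝ) : ℂ)) (((u k - u ℓ) : ℝ) : ℂ) (aux_sinh_ne _ hb _ (by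
          rw [sub_ne_zero]
          exact fun h => (Finset.ne_of_mem_erase hℓ) (hu h).symm)))
  refine key.congr' ?_
  filter_upwards [eventually_gt_atTop 0] with r hr
  have hr' : (r : ℂ) ≠ 0 := by exact_mod_cast hr.ne'
  have hpi : (Real.pi : ℂ) ≠ 0 := by exact_mod_cast Real.pi_ne_zero
  have hτ : Complex.I * N * ((2 * Real.pi * a * r : ℝ) : ℂ) / (2 * Real.pi * r ^ 2) =
      Complex.I * ((N * a : ℝ) : ℂ) / r := by
    push_cast
    field_simp
  unfold PhiA
  rw [hτ]
end
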